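/- arXiv:1304.4309 — 2 statements merged into one kernel-verified Lean document; each statement's English description precedes it below -/
import Mathlib

section
/- Let f be a simple set partition statistic of degree N defined by a pattern P̲ of length k and a polynomial Q ∈ ℚ[y_1,…,y_k,m]. Then there exist an integer range and polynomials Q_j ∈ ℚ[x] for −k ≤ j ≤ N such that for all n ≥ k, the aggregate M(f;n) := Σ_{λ ∈ Π(n)} f(λ) equals Σ_{j=−k}^{N} Q_j(n) B_{n+j}. Moreover the polynomial coefficient Q_{N−j} of B_{n+N−j} has degree at most j when 0 ≤ j ≤ N and degree at most j−1 when j > N. -/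
open Finset

/-- Set partitions of `[n]`, modeled as finpartitions of `Fin n`. -/
abbrev SetPartition (n : ℕ) := Finpartition (Finset.univ : Finset (Fin n))

/-- The `n`-th Bell number: the number of set partitions of `[n]`. -/
def bell (n : ℕ) : ℕ := Fintype.card (SetPartition n)

/-- `i` and `j` lie in the same block of the partition. -/
def SameBlock {n : ℕ} (P : SetPartition n) (i j : Fin n) : Prop :=
  ∃ b ∈ P.parts, i ∈ b ∧ j ∈ b

/-- `i` is the smallest element of its block. -/
def IsFirst {n : ℕ} (P : SetPartition n) (i : Fin n) : Prop :=
  ∀ j, SameBlock P i j → i ≤ j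

/-- `i` is the largest element of its block. -/
def IsLast {n : ℕ} (P : SetPartition n) (i : Fin n) : Prop :=
  ∀ j, SameBlock P i j → j ≤ i

/-- `(i, j)` is an arc: `i < j`, both in the same block, and `j` is the smallest
element of that block greater than `i`. -/
def IsArc {n : ℕ} (P : SetPartition n) (i j : Fin n) : Prop :=
  i < j ∧ SameBlock P i j ∧ ∀ k, i < k → k < j → ¬ SameBlock P i k

/-- The dimension exponent `d(λ) = Σ_blocks (max - min + 1) - n`. -/
def dimExp {n : ℕ} (P : SetPartition n) : ℤ :=
  (∑ b ∈ P.parts.attach,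
      (((b.1.max' (P.nonempty_of_mem_parts b.2)).val : ℤ)
        - ((b.1.min' (P.nonempty_of_mem_parts b.2)).val : ℤ) + 1)) - n

/-- The intertwining exponent (number of 2-crossings): the number of pairs of arcs
`(i₁,j₁), (i₂,j₂)` with `i₁ < i₂ < j₁ < j₂`. -/
noncomputable def inter {n : ℕ} (P : SetPartition n) : ℕ :=
  Set.ncard {q : (Fin n × Fin n) × (Fin n × Fin n) |
    IsArc P q.1.1 q.1.2 ∧ IsArc P q.2.1 q.2.2 ∧
    q.1.1 < q.2.1 ∧ q.2.1 < q.1.2 ∧ q.1.2 < q.2.2}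

/-- A pattern of length `k`: a set partition of `[k]` together with sets of firsts,
lasts, arcs, and consecutive pairs. -/
structure Pattern (k : ℕ) where
  part : SetPartition k
  F : Finset (Fin k)
  L : Finset (Fin k)
  A : Finset (Fin k × Fin k)
  C : Finset (Fin k × Fin k)

/-- `x` is an occurrence of the pattern `pat` in the set partition `P`. -/
def IsOccurrence {n k : ℕ} (pat : Pattern k) (P : SetPartition n) (x : Fin k → Fin n) : Prop :=
  StrictMono x ∧
  (∀ i j, SameBlock P (x i) (x j) ↔ SameBlock pat.part i j) ∧
  (∀ i ∈ pat.F, IsFirst P (x i)) ∧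
  (∀ i ∈ pat.L, IsLast P (x i)) ∧
  (∀ p ∈ pat.A, IsArc P (x p.1) (x p.2)) ∧
  (∀ p ∈ pat.C, |((x p.1).val : ℤ) - ((x p.2).val : ℤ)| = 1)

/-- The simple statistic associated to a pattern `pat` and a polynomial
`Q ∈ ℚ[y₁, …, y_k, m]` (the last variable playing the role of `m = n`):
`f_{P,Q}(λ) = Σ_{s ∈_P λ} Q(x₁, …, x_k, n)`, where elements of `[n] = {1, …, n}`
are identified with values `x.val + 1` for `x : Fin n`. -/
noncomputable def simpleStat {n k : ℕ} (pat : Pattern k) (Q : MvPolynomial (Fin (k + 1)) ℚ)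
    (P : SetPartition n) : ℚ :=
  ∑ᶠ x ∈ {x : Fin k → Fin n | IsOccurrence pat P x},
    MvPolynomial.eval (Fin.snoc (fun i => ((x i).val : ℚ) + 1) (n : ℚ)) Q

section BellFunctional

open Polynomial

/-- The falling factorials as a polynomial sequence. -/
noncomputable def descPochhammerSequence : Polynomial.Sequence ℚ where
  elems' := descPochhammer ℚ
  degree_eq' i := by
    rw [degree_eq_natDegree (monic_descPochhammer ℚ i).ne_zero, descPochhammer_natDegree]

theorem descPochhammerSequence_apply (i : ℕ) :
    descPochhammerSequence i = descPochhammer ℚ i := rfl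

/-- The basis of `ℚ[X]` formed by the falling factorials. -/
noncomputable def descPochhammerBasis : Module.Basis ℕ ℚ ℚ[X] :=
  descPochhammerSequence.basis fun i => by
    rw [descPochhammerSequence_apply, (monic_descPochhammer ℚ i).leadingCoeff]
    exact isUnit_one

theorem descPochhammerBasis_apply (i : ℕ) : descPochhammerBasis i = descPochhammer ℚ i :=
  descPochhammerSequence.basis_eq_self _ i

/-- The linear functional on `ℚ[X]` sending every falling factorial to `1`. -/
noncomputable def bellFunctional : ℚ[X] →ₗ[ℚ] ℚ :=
  descPochhammerBasis.constr ℚ fun _ => 1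

theorem bellFunctional_descPochhammer (i : ℕ) : bellFunctional (descPochhammer ℚ i) = 1 := by
  rw [← descPochhammerBasis_apply, bellFunctional, Module.Basis.constr_basis]

/-- Umbral shift: multiplying by a falling factorial of order `b` undoes a translation by `b`. -/
theorem bellFunctional_descPochhammer_mul_comp (b : ℕ) (p : ℚ[X]) :
    bellFunctional (descPochhammer ℚ b * p.comp (X - C (b : ℚ))) = bellFunctional p := by
  let φ : ℚ[X] →ₗ[ℚ] ℚ := bellFunctional ∘ₗ LinearMap.mulLeft ℚ (descPochhammer ℚ b) ∘ₗ
    (Polynomial.compRingHom (X - C (b : ℚ))).toAddMonoidHom.toRatLinearMap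
  have hφ : ∀ q, φ q = bellFunctional (descPochhammer ℚ b * q.comp (X - C (b : ℚ))) :=
    fun q => rfl
  suffices φ = bellFunctional by rw [← hφ, this]
  refine descPochhammerBasis.ext fun i => ?_
  rw [descPochhammerBasis_apply, hφ, map_natCast C b, descPochhammer_mul]
  simp only [bellFunctional_descPochhammer]

end BellFunctional

section Kernel

variable {n : ℕ}

theorem sameBlock_iff_part_eq (P : SetPartition n) (i j : Fin n) :
    SameBlock P i j ↔ P.part i = P.part j := by
  rw [← P.mem_part_iff_part_eq_part (mem_univ i) (mem_univ j), P.mem_part_iff_exists]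
  rfl

theorem setPartition_ext {P P' : SetPartition n}
    (h : ∀ i j, SameBlock P i j ↔ SameBlock P' i j) : P = P' := by
  have hp : ∀ i, P.part i = P'.part i := by
    intro i
    ext j
    rw [P.mem_part_iff_exists, P'.mem_part_iff_exists]
    exact h j i
  have key : ∀ {R R' : SetPartition n}, (∀ i, R.part i = R'.part i) → R.parts ⊆ R'.parts := by
    intro R R' hR b hb
    obtain ⟨i, hi⟩ := R.nonempty_of_mem_parts hb
    rw [← R.part_eq_of_mem hb hi, hR]
    exact R'.part_mem.2 (mem_univ i)
  ext1
  exact Finset.Subset.antisymm (key hp) (key fun i => (hp i).symm)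

open Classical in
/-- The set partition of `[n]` into the fibres of a function. -/
noncomputable def kernelPartition {α : Type*} (f : Fin n → α) : SetPartition n :=
  Finpartition.ofSetoid (Setoid.ker f)

theorem sameBlock_kernelPartition {α : Type*} (f : Fin n → α) (i j : Fin n) :
    SameBlock (kernelPartition f) i j ↔ f i = f j := by
  classical
  have h := Finpartition.mem_part_ofSetoid_iff_rel (s := Setoid.ker f) (a := j) (b := i)
  rw [Finpartition.mem_part_iff_exists] at h
  exact h.trans (by rw [Setoid.ker_def]; exact eq_comm)

theorem kernelPartition_eq_iff {α : Type*} (f : Fin n → α) (P : SetPartition n) :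
    kernelPartition f = P ↔ ∀ i j, f i = f j ↔ P.part i = P.part j := by
  constructor
  · rintro rfl i j
    rw [← sameBlock_kernelPartition, sameBlock_iff_part_eq]
  · intro h
    refine setPartition_ext fun i j => ?_
    rw [sameBlock_kernelPartition, h, sameBlock_iff_part_eq]

open Classical in
theorem card_kernelPartition_eq (P : SetPartition n) (q : ℕ) :
    #{f : Fin n → Fin q | kernelPartition f = P} = q.descFactorial #P.parts := by
  have hc : Fintype.card (P.parts ↪ Fin q) = q.descFactorial #P.parts := by
    rw [Fintype.card_embedding_eq]; simp
  rw [← hc, ← Finset.card_univ]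
  symm
  let c : Fin n → P.parts := fun i => ⟨P.part i, P.part_mem.2 (mem_univ i)⟩
  have hcs : Function.Surjective c := by
    rintro ⟨b, hb⟩
    obtain ⟨i, hi⟩ := P.nonempty_of_mem_parts hb
    exact ⟨i, Subtype.ext (P.part_eq_of_mem hb hi)⟩
  have hcc : ∀ i j, c i = c j ↔ P.part i = P.part j := fun i j => Subtype.ext_iff
  refine Finset.card_bij (fun e _ => e ∘ c) ?_ ?_ ?_
  · intro e _
    simp only [mem_filter, mem_univ, true_and, kernelPartition_eq_iff]
    intro i j
    simp [hcc]
  · intro e _ e' _ h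
    exact DFunLike.coe_injective (hcs.injective_comp_right h)
  · intro f hf
    simp only [mem_filter, mem_univ, true_and, kernelPartition_eq_iff] at hf
    obtain ⟨g, hg⟩ := hcs.hasRightInverse
    refine ⟨⟨fun b => f (g b), fun b b' h => ?_⟩, mem_univ _, ?_⟩
    · have := (hf _ _).1 h
      rwa [← hcc, hg, hg] at this
    · funext i
      change f (g (c i)) = f i
      rw [hf, ← hcc, hg]

open Classical in
theorem card_filter_kernelPartition (O : SetPartition n → Prop) (q : ℕ) :
    #{f : Fin n → Fin q | O (kernelPartition f)} =
      ∑ P : SetPartition n with O P, q.descFactorial #P.parts := by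
  rw [Finset.card_eq_sum_card_fiberwise (f := kernelPartition) (t := {P | O P})]
  · refine Finset.sum_congr rfl fun P hP => ?_
    rw [← card_kernelPartition_eq, Finset.filter_filter]
    congr 1
    ext f
    simp only [mem_filter, mem_univ, true_and] at hP ⊢
    exact ⟨fun h => h.2, fun h => ⟨h ▸ hP, h⟩⟩
  · intro f hf
    simpa using hf

open Polynomial in
open Classical in
/-- Counting functions with a given kernel property counts set partitions with that property. -/
theorem card_eq_bellFunctional (O : SetPartition n → Prop) (p : ℚ[X])
    (h : ∀ q : ℕ, (#{f : Fin n → Fin q | O (kernelPartition f)} : ℚ) = p.eval (q : ℚ)) :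
    (#{P : SetPartition n | O P} : ℚ) = bellFunctional p := by
  have hp : p = ∑ P : SetPartition n with O P, descPochhammer ℚ #P.parts := by
    refine Polynomial.eq_of_infinite_eval_eq _ _
      ((Set.infinite_range_of_injective (Nat.cast_injective (R := ℚ))).mono ?_)
    rintro _ ⟨q, rfl⟩
    change p.eval (q : ℚ) = _
    rw [← h, card_filter_kernelPartition, eval_finsetSum]
    push_cast
    exact Finset.sum_congr rfl fun P _ => (descPochhammer_eval_eq_descFactorial ℚ q _).symm
  rw [hp, map_sum]
  simp [bellFunctional_descPochhammer]

open Polynomial in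
theorem bellFunctional_X_pow (n : ℕ) : bellFunctional (X ^ n) = bell n := by
  classical
  rw [← card_eq_bellFunctional (n := n) (fun _ => True) (X ^ n) (by intro q; simp)]
  simp [bell]

end Kernel

section Occurrences

variable {n k : ℕ}

/-- The number of marked positions to the left of `y`. -/
def gapIndex (x : Fin k → Fin n) (y : Fin n) : ℕ := #{i | x i < y}

theorem lt_iff_lt_gapIndex {x : Fin k → Fin n} (hx : StrictMono x) (i : Fin k) (y : Fin n) :
    x i < y ↔ (i : ℕ) < gapIndex x y := by
  constructor
  · intro h
    have hs : Finset.Iic i ⊆ ({j | x j < y} : Finset (Fin k)) := by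
      intro j hj
      simp only [mem_filter, mem_univ, true_and]
      exact (hx.monotone (Finset.mem_Iic.1 hj)).trans_lt h
    have := Finset.card_le_card hs
    rw [Fin.card_Iic] at this
    exact this
  · intro h
    by_contra hn
    have hs : ({j | x j < y} : Finset (Fin k)) ⊆ Finset.Iio i := by
      intro j hj
      simp only [mem_filter, mem_univ, true_and] at hj
      exact Finset.mem_Iio.2 (hx.lt_iff_lt.1 (hj.trans_le (not_lt.1 hn)))
    have := Finset.card_le_card hs
    rw [Fin.card_Iio] at this
    exact absurd h (not_lt.2 this)

theorem lt_iff_gapIndex_le {x : Fin k → Fin n} (hx : StrictMono x) {y : Fin n}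
    (hy : y ∉ Set.range x) (i : Fin k) : y < x i ↔ gapIndex x y ≤ i := by
  rw [← not_lt, ← lt_iff_lt_gapIndex hx, not_lt]
  exact ⟨le_of_lt, fun h => lt_of_le_of_ne h fun e => hy ⟨i, e.symm⟩⟩

namespace Pattern

/-- The pattern positions whose blocks may not contain an unmarked element of the `g`-th gap. -/
def forbidden (pat : Pattern k) (g : ℕ) : Finset (Fin k) :=
  {i | (i ∈ pat.F ∧ g ≤ i) ∨ (i ∈ pat.L ∧ (i : ℕ) < g) ∨
    ∃ j, (i, j) ∈ pat.A ∧ (i : ℕ) < g ∧ g ≤ j}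

/-- The `g`-th gap must be empty because of a consecutivity condition. -/
def Blocked (pat : Pattern k) (g : ℕ) : Prop :=
  ∃ p ∈ pat.C, ((p.1 : ℕ) < g ∧ g ≤ p.2) ∨ ((p.2 : ℕ) < g ∧ g ≤ p.1)

/-- The conditions of the pattern hold within the pattern itself. -/
def Consistent (pat : Pattern k) : Prop :=
  (∀ i ∈ pat.F, IsFirst pat.part i) ∧ (∀ i ∈ pat.L, IsLast pat.part i) ∧
  (∀ p ∈ pat.A, IsArc pat.part p.1 p.2) ∧
  (∀ p ∈ pat.C, |((p.1 : ℕ) : ℤ) - ((p.2 : ℕ) : ℤ)| = 1)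

end Pattern

theorem abs_sub_eq_one_of_strictMono {x : Fin k → Fin n} (hx : StrictMono x) {i j : Fin k}
    (h : |((x i).val : ℤ) - ((x j).val : ℤ)| = 1) : |(i.val : ℤ) - (j.val : ℤ)| = 1 := by
  wlog hij : i ≤ j generalizing i j
  · rw [abs_sub_comm] at h ⊢
    exact this h (le_of_not_ge hij)
  have hle : ((x i).val : ℤ) ≤ (x j).val := by exact_mod_cast hx.monotone hij
  have hle' : (i.val : ℤ) ≤ j.val := by exact_mod_cast hij
  rw [abs_of_nonpos (by linarith)] at h ⊢
  have hne : i ≠ j := by rintro rfl; simp at h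
  have hlt : i.val < j.val := Fin.lt_def.1 (lt_of_le_of_ne hij hne)
  by_contra hcon
  have hm : i.val + 1 < j.val := by omega
  let m : Fin k := ⟨i.val + 1, hm.trans j.isLt⟩
  have h1 : x i < x m := hx (Fin.lt_def.2 (Nat.lt_succ_self _))
  have h2 : x m < x j := hx (Fin.lt_def.2 hm)
  rw [Fin.lt_def] at h1 h2
  omega

theorem IsOccurrence.consistent {pat : Pattern k} {P : SetPartition n} {x : Fin k → Fin n}
    (h : IsOccurrence pat P x) : pat.Consistent := by
  obtain ⟨hx, hs, hF, hL, hA, hC⟩ := h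
  refine ⟨fun i hi j hj => ?_, fun i hi j hj => ?_, fun p hp => ⟨?_, ?_, fun l h1 h2 hl => ?_⟩,
    fun p hp => abs_sub_eq_one_of_strictMono hx (hC p hp)⟩
  · exact hx.le_iff_le.1 (hF i hi _ ((hs i j).2 hj))
  · exact hx.le_iff_le.1 (hL i hi _ ((hs i j).2 hj))
  · exact hx.lt_iff_lt.1 (hA p hp).1
  · exact (hs _ _).1 (hA p hp).2.1
  · exact (hA p hp).2.2 _ (hx h1) (hx h2) ((hs _ _).2 hl)

theorem abs_sub_eq_one_iff {x : Fin k → Fin n} (hx : StrictMono x) {i j : Fin k}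
    (hij : |(i.val : ℤ) - (j.val : ℤ)| = 1) :
    |((x i).val : ℤ) - ((x j).val : ℤ)| = 1 ↔
      ∀ y ∉ Set.range x, ¬ ((i.val < gapIndex x y ∧ gapIndex x y ≤ j.val) ∨
        (j.val < gapIndex x y ∧ gapIndex x y ≤ i.val)) := by
  wlog hle : i ≤ j generalizing i j
  · rw [abs_sub_comm] at hij ⊢
    rw [this hij (le_of_not_ge hle)]
    simp only [or_comm]
  have hle' : (i.val : ℤ) ≤ j.val := by exact_mod_cast hle
  rw [abs_of_nonpos (by linarith)] at hij
  have hlt : x i < x j := hx (Fin.lt_def.2 (by omega))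
  rw [Fin.lt_def] at hlt
  constructor
  · intro h y hy hcon
    rw [abs_of_nonpos (by omega)] at h
    rw [← lt_iff_lt_gapIndex hx, ← lt_iff_lt_gapIndex hx, ← lt_iff_gapIndex_le hx hy,
      ← lt_iff_gapIndex_le hx hy] at hcon
    simp only [Fin.lt_def] at hcon
    omega
  · intro h
    by_contra hne
    rw [abs_of_nonpos (by omega)] at hne
    let y : Fin n := ⟨(x i).val + 1, by have := (x j).isLt; omega⟩
    have h1 : x i < y := Fin.lt_def.2 (Nat.lt_succ_self _)
    have h2 : y < x j := by
      rw [Fin.lt_def]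
      change (x i).val + 1 < (x j).val
      omega
    have hy : y ∉ Set.range x := by
      rintro ⟨l, hl⟩
      rw [← hl] at h1 h2
      have h1' := hx.lt_iff_lt.1 h1
      have h2' := hx.lt_iff_lt.1 h2
      rw [Fin.lt_def] at h1' h2'
      omega
    exact h y hy (Or.inl ⟨(lt_iff_lt_gapIndex hx _ _).1 h1, (lt_iff_gapIndex_le hx hy _).1 h2⟩)

theorem isOccurrence_kernelPartition_iff {pat : Pattern k} (hpat : pat.Consistent)
    {x : Fin k → Fin n} (hx : StrictMono x) {α : Type*} (f : Fin n → α) :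
    IsOccurrence pat (kernelPartition f) x ↔
      kernelPartition (f ∘ x) = pat.part ∧ ∀ y ∉ Set.range x, ¬ pat.Blocked (gapIndex x y) ∧
        ∀ i ∈ pat.forbidden (gapIndex x y), f y ≠ f (x i) := by
  obtain ⟨pF, pL, pA, pC⟩ := hpat
  have hker : (∀ i j, SameBlock (kernelPartition f) (x i) (x j) ↔ SameBlock pat.part i j) ↔
      kernelPartition (f ∘ x) = pat.part := by
    rw [kernelPartition_eq_iff]
    refine forall₂_congr fun i j => ?_
    rw [sameBlock_kernelPartition, sameBlock_iff_part_eq]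
    rfl
  unfold IsOccurrence
  rw [hker]
  refine ⟨fun ⟨_, hs, hF, hL, hA, hC⟩ => ⟨hs, fun y hy => ⟨?_, ?_⟩⟩,
    fun ⟨hs, h⟩ => ⟨hx, hs, ?_, ?_, ?_, ?_⟩⟩
  · rintro ⟨p, hp, hb⟩
    exact (abs_sub_eq_one_iff hx (pC p hp)).1 (hC p hp) y hy hb
  · intro i hi hfy
    simp only [Pattern.forbidden, mem_filter, mem_univ, true_and] at hi
    have hsame : SameBlock (kernelPartition f) (x i) y :=
      (sameBlock_kernelPartition f _ _).2 hfy.symm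
    rcases hi with ⟨hi, hg⟩ | ⟨hi, hg⟩ | ⟨j, hj, hg, hg'⟩
    · exact absurd (hF i hi y hsame) (not_le.2 ((lt_iff_gapIndex_le hx hy i).2 hg))
    · exact absurd (hL i hi y hsame) (not_le.2 ((lt_iff_lt_gapIndex hx i y).2 hg))
    · exact (hA _ hj).2.2 y ((lt_iff_lt_gapIndex hx i y).2 hg) ((lt_iff_gapIndex_le hx hy j).2 hg')
        hsame
  · intro i hi y hy
    by_cases hr : y ∈ Set.range x
    · obtain ⟨j, rfl⟩ := hr
      exact hx.monotone (pF i hi j ((hker.2 hs i j).1 hy))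
    · by_contra hlt
      refine (h y hr).2 i ?_ ((sameBlock_kernelPartition f _ _).1 hy).symm
      simp only [Pattern.forbidden, mem_filter, mem_univ, true_and]
      exact Or.inl ⟨hi, (lt_iff_gapIndex_le hx hr i).1 (not_le.1 hlt)⟩
  · intro i hi y hy
    by_cases hr : y ∈ Set.range x
    · obtain ⟨j, rfl⟩ := hr
      exact hx.monotone (pL i hi j ((hker.2 hs i j).1 hy))
    · by_contra hlt
      refine (h y hr).2 i ?_ ((sameBlock_kernelPartition f _ _).1 hy).symm
      simp only [Pattern.forbidden, mem_filter, mem_univ, true_and]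
      exact Or.inr (Or.inl ⟨hi, (lt_iff_lt_gapIndex hx i y).1 (not_le.1 hlt)⟩)
  · intro p hp
    obtain ⟨h1, h2, h3⟩ := pA p hp
    refine ⟨hx h1, (hker.2 hs _ _).2 h2, fun y hy1 hy2 hy => ?_⟩
    by_cases hr : y ∈ Set.range x
    · obtain ⟨j, rfl⟩ := hr
      exact h3 j (hx.lt_iff_lt.1 hy1) (hx.lt_iff_lt.1 hy2) ((hker.2 hs _ j).1 hy)
    · refine (h y hr).2 p.1 ?_ ((sameBlock_kernelPartition f _ _).1 hy).symm
      simp only [Pattern.forbidden, mem_filter, mem_univ, true_and]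
      exact Or.inr (Or.inr ⟨p.2, hp, (lt_iff_lt_gapIndex hx _ y).1 hy1,
        (lt_iff_gapIndex_le hx hr _).1 hy2⟩)
  · intro p hp
    rw [abs_sub_eq_one_iff hx (pC p hp)]
    exact fun y hy hb => (h y hy).1 ⟨p, hp, hb⟩

open Classical in
/-- The umbral weight of an unmarked element of the `g`-th gap. -/
noncomputable def Pattern.gapWeight (pat : Pattern k) (g : ℕ) : Polynomial ℚ :=
  if pat.Blocked g then 0
  else Polynomial.X - Polynomial.C (#((pat.forbidden g).image pat.part.part) : ℚ)

theorem card_image_eq_of_kernelPartition_eq {P : SetPartition k} {α : Type*} [DecidableEq α]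
    {g : Fin k → α} (hg : kernelPartition g = P) (s : Finset (Fin k)) :
    #(s.image g) = #(s.image P.part) := by
  rw [kernelPartition_eq_iff] at hg
  have h : ∀ b ∈ s.image g, ∃ c ∈ s.image P.part, ∃ i ∈ s, g i = b ∧ P.part i = c := by
    intro b hb
    obtain ⟨i, hi, rfl⟩ := Finset.mem_image.1 hb
    exact ⟨_, Finset.mem_image_of_mem _ hi, i, hi, rfl, rfl⟩
  choose! φ h1 ψ h2 h3 h4 using h
  refine Finset.card_bij (fun b _ => φ b) h1 ?_ ?_
  · intro b hb b' hb' hbb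
    rw [← h3 b hb, ← h3 b' hb', hg, h4 b hb, h4 b' hb', hbb]
  · intro c hc
    obtain ⟨i, hi, rfl⟩ := Finset.mem_image.1 hc
    have hb := Finset.mem_image_of_mem g hi
    exact ⟨g i, hb, by rw [← h4 _ hb, ← hg, h3 _ hb]⟩

open Polynomial in
open Classical in
theorem card_functions_isOccurrence {pat : Pattern k} (hpat : pat.Consistent)
    {x : Fin k → Fin n} (hx : StrictMono x) (q : ℕ) :
    (#{f : Fin n → Fin q | IsOccurrence pat (kernelPartition f) x} : ℚ) =
      (descPochhammer ℚ #pat.part.parts *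
        ∏ y : Fin n with y ∉ Set.range x, pat.gapWeight (gapIndex x y)).eval (q : ℚ) := by
  simp only [isOccurrence_kernelPartition_iff hpat hx]
  rw [Finset.card_eq_sum_card_fiberwise (f := fun f => f ∘ x)
    (t := {g : Fin k → Fin q | kernelPartition g = pat.part}) (by
      intro f hf
      simp only [coe_filter, mem_univ, true_and, Set.mem_ofPred_eq] at hf ⊢
      exact hf.1)]
  rw [eval_mul, descPochhammer_eval_eq_descFactorial, ← card_kernelPartition_eq]
  push_cast
  rw [← nsmul_eq_mul, ← Finset.sum_const]
  refine Finset.sum_congr rfl fun g hg => ?_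
  simp only [mem_filter, mem_univ, true_and] at hg
  let t : Fin n → Finset (Fin q) := fun y =>
    if h : ∃ i, x i = y then {g h.choose}
    else if pat.Blocked (gapIndex x y) then ∅
    else ((pat.forbidden (gapIndex x y)).image g)ᶜ
  have htx : ∀ i, t (x i) = {g i} := by
    intro i
    have h : ∃ j, x j = x i := ⟨i, rfl⟩
    simp only [t, dif_pos h]
    rw [hx.injective h.choose_spec]
  have hty : ∀ y ∉ Set.range x, t y = if pat.Blocked (gapIndex x y) then ∅
      else ((pat.forbidden (gapIndex x y)).image g)ᶜ := by
    intro y hy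
    simp only [t]
    rw [dif_neg (by simpa using hy)]
  have hset : (({f : Fin n → Fin q | kernelPartition (f ∘ x) = pat.part ∧
      ∀ y ∉ Set.range x, ¬ pat.Blocked (gapIndex x y) ∧
        ∀ i ∈ pat.forbidden (gapIndex x y), f y ≠ f (x i)} : Finset _).filter
          fun f => f ∘ x = g) = Fintype.piFinset t := by
    ext f
    simp only [mem_filter, mem_univ, true_and, Fintype.mem_piFinset]
    constructor
    · rintro ⟨⟨-, h⟩, rfl⟩ y
      by_cases hy : y ∈ Set.range x
      · obtain ⟨i, rfl⟩ := hy
        simp [htx]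
      · rw [hty y hy, if_neg (h y hy).1]
        simp only [mem_compl, mem_image, not_exists, not_and]
        exact fun i hi e => (h y hy).2 i hi e.symm
    · intro h
      have hfg : f ∘ x = g := by
        funext i
        have := h (x i)
        rw [htx] at this
        simpa using this
      refine ⟨⟨hfg ▸ hg, fun y hy => ?_⟩, hfg⟩
      have hy' := h y
      rw [hty y hy] at hy'
      split_ifs at hy' with hb
      · simp at hy'
      · refine ⟨hb, fun i hi e => ?_⟩
        simp only [mem_compl, mem_image, not_exists, not_and] at hy'
        exact hy' i hi (by rw [e, ← hfg]; rfl)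
  rw [hset, Fintype.card_piFinset, ← Finset.prod_filter_mul_prod_filter_not univ
    (fun y => y ∉ Set.range x), Nat.cast_mul]
  have h1 : ∏ y : Fin n with ¬ y ∉ Set.range x, #(t y) = 1 := by
    refine Finset.prod_eq_one fun y hy => ?_
    simp only [mem_filter, mem_univ, true_and, not_not] at hy
    obtain ⟨i, rfl⟩ := hy
    simp [htx]
  rw [h1, Nat.cast_one, mul_one, eval_prod]
  push_cast
  refine Finset.prod_congr rfl fun y hy => ?_
  simp only [mem_filter, mem_univ, true_and] at hy
  rw [hty y hy, Pattern.gapWeight]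
  split_ifs with hb
  · simp
  · rw [Finset.card_compl, Nat.cast_sub (Finset.card_le_univ _),
      card_image_eq_of_kernelPartition_eq hg]
    simp

open Classical in
/-- The number of set partitions in which `x` is an occurrence of a consistent pattern. -/
theorem card_isOccurrence {pat : Pattern k} (hpat : pat.Consistent)
    {x : Fin k → Fin n} (hx : StrictMono x) :
    (#{P : SetPartition n | IsOccurrence pat P x} : ℚ) =
      bellFunctional (descPochhammer ℚ #pat.part.parts *
        ∏ y : Fin n with y ∉ Set.range x, pat.gapWeight (gapIndex x y)) :=
  card_eq_bellFunctional _ _ (card_functions_isOccurrence hpat hx)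

end Occurrences

section ExponentialPolynomials

open Polynomial

/-- The sequences of polynomials spanned by `m ↦ m ^ s X ^ t (X - b) ^ m`
with `s + t ≤ d` and `b ≤ l`. -/
noncomputable def expPolySpan (l d : ℕ) : Submodule ℚ (ℕ → ℚ[X]) :=
  Submodule.span ℚ {U | ∃ s t b : ℕ, s + t ≤ d ∧ b ≤ l ∧
    U = fun m : ℕ => C ((m : ℚ) ^ s) * X ^ t * (X - C (b : ℚ)) ^ m}

variable {l d : ℕ} {U : ℕ → ℚ[X]}

theorem mem_expPolySpan {s t b : ℕ} (hst : s + t ≤ d) (hb : b ≤ l) :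
    (fun m : ℕ => C ((m : ℚ) ^ s) * X ^ t * (X - C (b : ℚ)) ^ m) ∈ expPolySpan l d :=
  Submodule.subset_span ⟨s, t, b, hst, hb, rfl⟩

theorem expPolySpan_mono {d' : ℕ} (h : d ≤ d') : expPolySpan l d ≤ expPolySpan l d' := by
  refine Submodule.span_mono ?_
  rintro _ ⟨s, t, b, hst, hb, rfl⟩
  exact ⟨s, t, b, hst.trans h, hb, rfl⟩

theorem map_expPolySpan_le {d' : ℕ} {M : Type*} [AddCommGroup M] [Module ℚ M]
    (φ : (ℕ → ℚ[X]) →ₗ[ℚ] M) (S : Submodule ℚ M)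
    (h : ∀ s t b : ℕ, s + t ≤ d' → b ≤ l →
      φ (fun m : ℕ => C ((m : ℚ) ^ s) * X ^ t * (X - C (b : ℚ)) ^ m) ∈ S)
    (hU : U ∈ expPolySpan l d') : φ U ∈ S := by
  have : expPolySpan l d' ≤ S.comap φ := by
    refine Submodule.span_le.2 ?_
    rintro _ ⟨s, t, b, hst, hb, rfl⟩
    exact h s t b hst hb
  exact this hU

theorem X_mul_mem_expPolySpan (hU : U ∈ expPolySpan l d) :
    (fun m => X * U m) ∈ expPolySpan l (d + 1) := by
  refine map_expPolySpan_le (LinearMap.mulLeft ℚ (fun _ => X : ℕ → ℚ[X])) _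
    (fun s t b hst hb => ?_) hU
  convert mem_expPolySpan (s := s) (t := t + 1) (b := b) (d := d + 1) (l := l) (by omega) hb
    using 1
  funext m
  simp only [LinearMap.mulLeft_apply, Pi.mul_apply]
  ring

theorem X_pow_mul_mem_expPolySpan (hU : U ∈ expPolySpan l d) (t : ℕ) :
    (fun m => X ^ t * U m) ∈ expPolySpan l (d + t) := by
  induction t with
  | zero => simpa using hU
  | succ t ih =>
    change _ ∈ expPolySpan l (d + t + 1)
    convert X_mul_mem_expPolySpan ih using 1
    funext m
    ring

theorem C_mul_mem_expPolySpan (hU : U ∈ expPolySpan l d) (a : ℚ) :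
    (fun m => C a * U m) ∈ expPolySpan l d := by
  convert (expPolySpan l d).smul_mem a hU using 1
  funext m
  simp [smul_eq_C_mul]

theorem X_sub_C_mul_mem_expPolySpan (hU : U ∈ expPolySpan l d) (a : ℚ) :
    (fun m => (X - C a) * U m) ∈ expPolySpan l (d + 1) := by
  convert (expPolySpan l (d + 1)).sub_mem (X_mul_mem_expPolySpan hU)
    (expPolySpan_mono (Nat.le_succ d) (C_mul_mem_expPolySpan hU a)) using 1
  funext m
  simp only [Pi.sub_apply]
  ring

theorem index_mul_mem_expPolySpan (hU : U ∈ expPolySpan l d) :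
    (fun m : ℕ => C (m : ℚ) * U m) ∈ expPolySpan l (d + 1) := by
  refine map_expPolySpan_le (LinearMap.mulLeft ℚ (fun m : ℕ => C (m : ℚ) : ℕ → ℚ[X])) _
    (fun s t b hst hb => ?_) hU
  convert mem_expPolySpan (s := s + 1) (t := t) (b := b) (d := d + 1) (l := l) (by omega) hb
    using 1
  funext m
  simp only [LinearMap.mulLeft_apply, Pi.mul_apply, pow_succ, C_mul]
  ring

theorem index_add_pow_mul_mem_expPolySpan (hU : U ∈ expPolySpan l d) (a : ℚ) (e : ℕ) :
    (fun m : ℕ => C (((m : ℚ) + a) ^ e) * U m) ∈ expPolySpan l (d + e) := by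
  induction e with
  | zero => simpa using hU
  | succ e ih =>
    convert (expPolySpan l (d + (e + 1))).add_mem (index_mul_mem_expPolySpan ih)
      (expPolySpan_mono (Nat.le_succ (d + e)) (C_mul_mem_expPolySpan ih a)) using 1
    funext m
    simp only [Pi.add_apply, pow_succ, C_mul, C_add]
    ring

/-- Convolution with the powers of a polynomial. -/
noncomputable def powConv (D : ℚ[X]) : (ℕ → ℚ[X]) →ₗ[ℚ] (ℕ → ℚ[X]) where
  toFun U m := ∑ p ∈ antidiagonal m, U p.1 * D ^ p.2
  map_add' U V := by
    funext m
    simp [add_mul, Finset.sum_add_distrib]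
  map_smul' a U := by
    funext m
    simp [Finset.smul_sum]

theorem powConv_zero_index (D : ℚ[X]) (U : ℕ → ℚ[X]) : powConv D U 0 = U 0 := by
  simp [powConv]

theorem powConv_succ (D : ℚ[X]) (U : ℕ → ℚ[X]) (m : ℕ) :
    powConv D U (m + 1) = D * powConv D U m + U (m + 1) := by
  change ∑ p ∈ antidiagonal (m + 1), U p.1 * D ^ p.2 =
    D * ∑ p ∈ antidiagonal m, U p.1 * D ^ p.2 + U (m + 1)
  rw [Finset.Nat.sum_antidiagonal_succ', Finset.mul_sum]
  simp only [pow_zero, mul_one]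
  rw [add_comm]
  congr 1
  exact Finset.sum_congr rfl fun p _ => by ring

theorem eq_powConv {D : ℚ[X]} {U V : ℕ → ℚ[X]} (h0 : V 0 = U 0)
    (hs : ∀ m, V (m + 1) = D * V m + U (m + 1)) : V = powConv D U := by
  funext m
  induction m with
  | zero => rw [h0, powConv_zero_index]
  | succ m ih => rw [hs, ih, powConv_succ]

theorem powConv_mul_left (D G : ℚ[X]) (U : ℕ → ℚ[X]) :
    powConv D (fun m => G * U m) = fun m => G * powConv D U m := by
  symm
  refine eq_powConv ?_ fun m => ?_
  · rw [powConv_zero_index]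
  · rw [powConv_succ]; ring

theorem powConv_telescope (D : ℚ[X]) (F : ℕ → ℚ[X]) :
    powConv D (fun m => F (m + 1) - D * F m) = fun m => F (m + 1) - F 0 * D ^ (m + 1) := by
  symm
  refine eq_powConv (by ring) fun m => by ring

theorem powConv_pow_self (D : ℚ[X]) (p : ℕ → ℚ) :
    powConv D (fun m => C (p m) * D ^ m) =
      fun m => C (∑ y ∈ Finset.range (m + 1), p y) * D ^ m := by
  symm
  refine eq_powConv (by simp) fun m => ?_
  rw [Finset.sum_range_succ _ (m + 1), C_add]
  ring

theorem powConv_self_mem_expPolySpan {b : ℕ} (hb : b ≤ l) (s : ℕ) :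
    powConv (X - C (b : ℚ)) (fun m : ℕ => C ((m : ℚ) ^ s) * (X - C (b : ℚ)) ^ m) ∈
      expPolySpan l (s + 1) := by
  rw [powConv_pow_self]
  simp only [sum_range_pow]
  have hmem : ∀ i ∈ Finset.range (s + 1),
      (fun m : ℕ => C (_root_.bernoulli i * ((s + 1).choose i : ℚ) / ((s : ℚ) + 1)) *
        (C (((m : ℚ) + 1) ^ (s + 1 - i)) * (X - C (b : ℚ)) ^ m)) ∈ expPolySpan l (s + 1) := by
    intro i _
    refine C_mul_mem_expPolySpan ?_ _
    have h0 := mem_expPolySpan (s := 0) (t := 0) (b := b) (d := 0) (l := l) le_rfl hb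
    simp only [pow_zero, map_one, one_mul] at h0
    exact expPolySpan_mono (by omega) (index_add_pow_mul_mem_expPolySpan h0 1 (s + 1 - i))
  convert (expPolySpan l (s + 1)).sum_mem hmem using 1
  funext m
  rw [Finset.sum_apply, map_sum, Finset.sum_mul]
  refine Finset.sum_congr rfl fun i _ => ?_
  rw [← mul_assoc, ← C_mul]
  congr 2
  push_cast
  ring

theorem powConv_ne_mem_expPolySpan {a b : ℕ} (ha : a ≤ l) (hb : b ≤ l) (hab : a ≠ b) (s : ℕ) :
    powConv (X - C (b : ℚ)) (fun m : ℕ => C ((m : ℚ) ^ s) * (X - C (a : ℚ)) ^ m) ∈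
      expPolySpan l (s + 1) := by
  induction s using Nat.strong_induction_on with
  | _ s ih =>
  set A : ℚ[X] := X - C (a : ℚ) with hA
  set D : ℚ[X] := X - C (b : ℚ) with hD
  let G : ℕ → ℕ → ℚ[X] := fun r m => C ((m : ℚ) ^ r) * A ^ m
  let c : ℚ := (b : ℚ) - a
  have hc : c ≠ 0 := sub_ne_zero.2 (by exact_mod_cast hab.symm)
  have hAD : A - D = C c := by
    simp only [hA, hD, c, C_sub]; ring
  have key : powConv D (G s) = c⁻¹ • ((fun m => G s (m + 1) - G s 0 * D ^ (m + 1)) -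
      ∑ r ∈ Finset.range s, fun m => C (s.choose r : ℚ) * (A * powConv D (G r) m)) := by
    rw [eq_inv_smul_iff₀ hc, eq_sub_iff_add_eq, ← powConv_telescope]
    have : (fun m => G s (m + 1) - D * G s m) =
        c • G s + ∑ r ∈ Finset.range s, (s.choose r : ℚ) • fun m => A * G r m := by
      funext m
      simp only [G, Pi.add_apply, Pi.smul_apply, Finset.sum_apply, smul_eq_C_mul, ← hAD]
      have hp : ((m + 1 : ℕ) : ℚ) ^ s =
          ∑ r ∈ Finset.range s, (s.choose r : ℚ) * (m : ℚ) ^ r + (m : ℚ) ^ s := by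
        push_cast
        rw [add_pow, Finset.sum_range_succ]
        simp [mul_comm]
      rw [hp, C_add, map_sum, add_mul, Finset.sum_mul, pow_succ]
      have : ∀ r ∈ Finset.range s, C ((s.choose r : ℚ) * (m : ℚ) ^ r) * (A ^ m * A) =
          C (s.choose r : ℚ) * (A * (C ((m : ℚ) ^ r) * A ^ m)) := by
        intro r _
        rw [C_mul]; ring
      rw [Finset.sum_congr rfl this]
      ring
    rw [this, map_add, map_smul, map_sum]
    congr 1
    refine Finset.sum_congr rfl fun r _ => ?_
    rw [map_smul, powConv_mul_left]
    funext m
    simp [smul_eq_C_mul]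
  change powConv D (G s) ∈ _
  rw [key]
  have h0 : ∀ {b' : ℕ}, b' ≤ l → (fun m => (X - C (b' : ℚ)) ^ m) ∈ expPolySpan l 0 := by
    intro b' hb'
    have h0 := mem_expPolySpan (s := 0) (t := 0) (b := b') (d := 0) (l := l) le_rfl hb'
    simpa only [pow_zero, map_one, one_mul] using h0
  refine Submodule.smul_mem _ _ (Submodule.sub_mem _ (Submodule.sub_mem _
    (x := fun m => G s (m + 1)) (y := fun m => G s 0 * D ^ (m + 1)) ?_ ?_)
    (Submodule.sum_mem _ fun r hr => ?_))
  · convert expPolySpan_mono (d := 0 + 1 + s) (d' := s + 1) (by omega)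
      (index_add_pow_mul_mem_expPolySpan (X_sub_C_mul_mem_expPolySpan (h0 ha) (a : ℚ)) 1 s) using 1
    funext m
    simp only [G, pow_succ, hA]
    push_cast
    ring
  · convert expPolySpan_mono (d := 0 + 1) (d' := s + 1) (by omega) (C_mul_mem_expPolySpan
      (X_sub_C_mul_mem_expPolySpan (h0 hb) (b : ℚ)) (((0 : ℕ) : ℚ) ^ s)) using 1
    funext m
    simp only [G, pow_succ, hD]
    ring
  · have hr' := Finset.mem_range.1 hr
    exact expPolySpan_mono (by omega)
      (C_mul_mem_expPolySpan (X_sub_C_mul_mem_expPolySpan (ih r hr') (a : ℚ)) _)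

theorem powConv_mem_expPolySpan {b : ℕ} (hb : b ≤ l) (hU : U ∈ expPolySpan l d) :
    powConv (X - C (b : ℚ)) U ∈ expPolySpan l (d + 1) := by
  refine map_expPolySpan_le _ _ (fun s t a hst ha => ?_) hU
  have h : (fun m : ℕ => C ((m : ℚ) ^ s) * X ^ t * (X - C (a : ℚ)) ^ m) =
      fun m : ℕ => X ^ t * (C ((m : ℚ) ^ s) * (X - C (a : ℚ)) ^ m) := by
    funext m; ring
  rw [h, powConv_mul_left]
  refine expPolySpan_mono (d := s + 1 + t) (by omega) (X_pow_mul_mem_expPolySpan ?_ t)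
  rcases eq_or_ne a b with rfl | hab
  · exact powConv_self_mem_expPolySpan hb s
  · exact powConv_ne_mem_expPolySpan ha hb hab s

theorem powConv_zero (U : ℕ → ℚ[X]) : powConv 0 U = U :=
  (eq_powConv rfl fun m => by ring).symm

/-- Sum over the `k`-element subsets `s` of `{0, …, n - 1}`, the `i`-th element `y` of `s`
contributing `h i y` and every other element preceded by `g` elements of `s` contributing `w g`. -/
noncomputable def markedSum (w : ℕ → ℚ[X]) (h : ℕ → ℕ → ℚ) (k n : ℕ) : ℚ[X] :=
  ∑ s ∈ Finset.powersetCard k (Finset.range n), ∏ y ∈ Finset.range n,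
    if y ∈ s then C (h #{z ∈ s | z < y} y) else w #{z ∈ s | z < y}

theorem markedSum_zero (w : ℕ → ℚ[X]) (h : ℕ → ℕ → ℚ) (n : ℕ) :
    markedSum w h 0 n = w 0 ^ n := by
  simp [markedSum]

theorem markedSum_of_lt (w : ℕ → ℚ[X]) (h : ℕ → ℕ → ℚ) {k n : ℕ} (hn : n < k) :
    markedSum w h k n = 0 := by
  rw [markedSum, Finset.powersetCard_eq_empty.2 (by simpa using hn), Finset.sum_empty]

theorem markedSum_succ_succ (w : ℕ → ℚ[X]) (h : ℕ → ℕ → ℚ) (k n : ℕ) :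
    markedSum w h (k + 1) (n + 1) =
      w (k + 1) * markedSum w h (k + 1) n + C (h k n) * markedSum w h k n := by
  have hn : n ∉ Finset.range n := Finset.notMem_range_self
  have hsub : ∀ {j : ℕ} {s : Finset ℕ}, s ∈ Finset.powersetCard j (Finset.range n) →
      n ∉ s ∧ {z ∈ s | z < n} = s ∧ #s = j := by
    intro j s hs
    obtain ⟨hs1, hs2⟩ := Finset.mem_powersetCard.1 hs
    exact ⟨fun hc => hn (hs1 hc),
      Finset.filter_true_of_mem fun z hz => Finset.mem_range.1 (hs1 hz), hs2⟩
  unfold markedSum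
  rw [Finset.range_add_one, Finset.powersetCard_succ_insert hn, Finset.sum_union, Finset.sum_image]
  · rw [Finset.mul_sum, Finset.mul_sum]
    congr 1
    · refine Finset.sum_congr rfl fun s hs => ?_
      obtain ⟨h1, h2, h3⟩ := hsub hs
      rw [Finset.prod_insert hn, if_neg h1, h2, h3]
    · refine Finset.sum_congr rfl fun s hs => ?_
      obtain ⟨h1, h2, h3⟩ := hsub hs
      have hcnt : ∀ y ≤ n, {z ∈ insert n s | z < y} = {z ∈ s | z < y} := by
        intro y hy
        rw [Finset.filter_insert, if_neg (not_lt.2 hy)]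
      rw [Finset.prod_insert hn, if_pos (Finset.mem_insert_self n s), hcnt n le_rfl, h2, h3]
      congr 1
      refine Finset.prod_congr rfl fun y hy => ?_
      have hy' := Finset.mem_range.1 hy
      rw [hcnt y hy'.le]
      simp only [Finset.mem_insert, hy'.ne, false_or]
  · intro s hs s' hs' hss
    have h1 := (hsub hs).1
    have h2 := (hsub hs').1
    rw [← Finset.erase_insert h1, ← Finset.erase_insert h2, hss]
  · rw [Finset.disjoint_left]
    intro s hs hs'
    obtain ⟨s', -, rfl⟩ := Finset.mem_image.1 hs'
    exact (hsub hs).1 (Finset.mem_insert_self n s')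

theorem markedSum_mem_expPolySpan {w : ℕ → ℚ[X]} (hw0 : ∃ b ≤ l, w 0 = X - C (b : ℚ))
    (hw : ∀ g, w g = 0 ∨ ∃ b ≤ l, w g = X - C (b : ℚ)) (e : ℕ → ℕ) (k : ℕ) :
    (fun m => markedSum w (fun i y => ((y : ℚ) + 1) ^ e i) k (m + k)) ∈
      expPolySpan l (k + ∑ i ∈ Finset.range k, e i) := by
  induction k with
  | zero =>
    obtain ⟨b, hb, hwb⟩ := hw0
    simp only [markedSum_zero, hwb, add_zero, Finset.range_zero, Finset.sum_empty]
    have h0 := mem_expPolySpan (s := 0) (t := 0) (b := b) (d := 0) (l := l) le_rfl hb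
    simpa only [pow_zero, map_one, one_mul] using h0
  | succ k ih =>
    set h : ℕ → ℕ → ℚ := fun i y => ((y : ℚ) + 1) ^ e i with hh
    have hrec : (fun m => markedSum w h (k + 1) (m + (k + 1))) =
        powConv (w (k + 1)) (fun m : ℕ => C (((m : ℚ) + (k + 1)) ^ e k) * markedSum w h k (m + k)) := by
      refine eq_powConv ?_ fun m => ?_
      · rw [zero_add, markedSum_succ_succ, markedSum_of_lt _ _ (Nat.lt_succ_self k)]
        simp [hh]
      · rw [show m + 1 + (k + 1) = (m + (k + 1)) + 1 by ring, markedSum_succ_succ,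
          show m + 1 + k = m + (k + 1) by ring]
        simp only [hh]
        push_cast
        ring_nf
    rw [hrec, Finset.sum_range_succ]
    have hmem := index_add_pow_mul_mem_expPolySpan ih ((k : ℚ) + 1) (e k)
    rcases hw (k + 1) with h0 | ⟨b, hb, hwb⟩
    · rw [h0, powConv_zero]
      exact expPolySpan_mono (d := k + ∑ i ∈ Finset.range k, e i + e k) (by omega) hmem
    · rw [hwb]
      exact expPolySpan_mono (d := k + ∑ i ∈ Finset.range k, e i + e k + 1) (by omega)
        (powConv_mem_expPolySpan hb hmem)

end ExponentialPolynomials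

section ShiftedBell

open Polynomial

/-- `φ m`, as a function of `n = m + k`, is a shifted Bell polynomial with shifts from `-k` to `N`
and coefficient degrees bounded by `β`. -/
def IsShiftedBell (k N : ℕ) (β : ℤ → ℕ) (φ : ℕ → ℚ) : Prop :=
  ∃ R : ℤ → ℚ[X],
    (∀ m : ℕ, φ m = ∑ j ∈ Finset.Icc (-(k : ℤ)) N,
      (R j).eval ((m : ℚ) + k) * (bell ((m : ℤ) + k + j).toNat : ℚ)) ∧
    ∀ j ∈ Finset.Icc (-(k : ℤ)) N, (R j).natDegree ≤ β j

/-- The shifted Bell polynomials with given degree bounds, as a submodule. -/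
def shiftedBellSubmodule (k N : ℕ) (β : ℤ → ℕ) : Submodule ℚ (ℕ → ℚ) where
  carrier := {φ | IsShiftedBell k N β φ}
  zero_mem' := ⟨fun _ => 0, by simp, by simp⟩
  add_mem' := by
    rintro φ ψ ⟨R, h1, h2⟩ ⟨R', h1', h2'⟩
    refine ⟨fun j => R j + R' j, fun m => ?_, fun j hj =>
      natDegree_add_le_of_degree_le (h2 j hj) (h2' j hj)⟩
    rw [Pi.add_apply, h1, h1', ← Finset.sum_add_distrib]
    exact Finset.sum_congr rfl fun j _ => by rw [eval_add]; ring
  smul_mem' := by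
    rintro a φ ⟨R, h1, h2⟩
    refine ⟨fun j => C a * R j, fun m => ?_, fun j hj =>
      (natDegree_C_mul_le a _).trans (h2 j hj)⟩
    rw [Pi.smul_apply, h1, smul_eq_mul, Finset.mul_sum]
    exact Finset.sum_congr rfl fun j _ => by rw [eval_C_mul]; ring

theorem mem_shiftedBellSubmodule {k N : ℕ} {β : ℤ → ℕ} {φ : ℕ → ℚ} :
    φ ∈ shiftedBellSubmodule k N β ↔ IsShiftedBell k N β φ := Iff.rfl

theorem sum_Icc_neg_eq_sum_range {M : Type*} [AddCommMonoid M] (k N : ℕ) (f : ℤ → M) :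
    ∑ j ∈ Finset.Icc (-(k : ℤ)) N, f j = ∑ i ∈ Finset.range (N + k + 1), f ((i : ℤ) - k) := by
  symm
  refine Finset.sum_nbij' (fun i : ℕ => (i : ℤ) - k) (fun j : ℤ => (j + k).toNat) ?_ ?_ ?_ ?_ ?_
  · intro i hi
    simp only [Finset.mem_range, Finset.mem_Icc] at hi ⊢
    omega
  · intro j hj
    simp only [Finset.mem_range, Finset.mem_Icc] at hj ⊢
    omega
  · intro i _
    simp
  · intro j hj
    simp only [Finset.mem_Icc] at hj
    omega
  · intro i _
    rfl

theorem bellFunctional_mul_X_pow {g : ℚ[X]} {D : ℕ} (hg : g.natDegree < D) (m : ℕ) :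
    bellFunctional (g * X ^ m) = ∑ i ∈ Finset.range D, g.coeff i * bell (m + i) := by
  conv_lhs => rw [g.as_sum_range' D hg, Finset.sum_mul, map_sum]
  refine Finset.sum_congr rfl fun i _ => ?_
  rw [← C_mul_X_pow_eq_monomial, mul_assoc, ← pow_add, ← smul_eq_C_mul, map_smul,
    bellFunctional_X_pow, smul_eq_mul, add_comm i m]

/-- Evaluating the functional on `(X)_l X ^ t (X - b) ^ m` with `b ≤ l`. -/
theorem bellFunctional_descPochhammer_mul_X_sub_pow {l b : ℕ} (hb : b ≤ l) (t m : ℕ) :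
    bellFunctional (descPochhammer ℚ l * (X ^ t * (X - C (b : ℚ)) ^ m)) =
      bellFunctional (descPochhammer ℚ (l - b) * (X + C (b : ℚ)) ^ t * X ^ m) := by
  conv_rhs => rw [← bellFunctional_descPochhammer_mul_comp b]
  congr 1
  have h := descPochhammer_mul (R := ℚ) b (l - b)
  rw [Nat.add_sub_cancel' hb, ← map_natCast C b] at h
  rw [← h]
  simp only [mul_comp, pow_comp, add_comp, X_comp, C_comp, sub_add_cancel]
  ring

theorem isShiftedBell_of_mem_expPolySpan {k l N : ℕ} {β : ℤ → ℕ} (hl : l ≤ k)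
    (hβ : ∀ j : ℤ, -(k : ℤ) ≤ j → ∀ s : ℕ, s ≤ N → (s : ℤ) + j ≤ N → s ≤ β j)
    {U : ℕ → ℚ[X]} (hU : U ∈ expPolySpan l N) :
    IsShiftedBell k N β (fun m => bellFunctional (descPochhammer ℚ l * U m)) := by
  let φ : (ℕ → ℚ[X]) →ₗ[ℚ] (ℕ → ℚ) :=
    { toFun := fun V m => bellFunctional (descPochhammer ℚ l * V m)
      map_add' := fun V W => by funext m; simp [mul_add]
      map_smul' := fun a V => by funext m; simp }
  refine mem_shiftedBellSubmodule.1 (?_ : φ U ∈ shiftedBellSubmodule k N β)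
  refine map_expPolySpan_le φ _ (fun s t b hst hb => ?_) hU
  set g : ℚ[X] := descPochhammer ℚ (l - b) * (X + C (b : ℚ)) ^ t with hg
  have hgd : g.natDegree ≤ k + t := by
    refine natDegree_mul_le.trans (add_le_add ?_ ?_)
    · rw [descPochhammer_natDegree]; omega
    · rw [natDegree_pow, natDegree_X_add_C, mul_one]
  refine mem_shiftedBellSubmodule.2 ⟨fun j => C (g.coeff (j + k).toNat) * (X - C (k : ℚ)) ^ s, fun m => ?_, fun j hj => ?_⟩
  · change bellFunctional (descPochhammer ℚ l *
      (C ((m : ℚ) ^ s) * X ^ t * (X - C (b : ℚ)) ^ m)) = _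
    have hr : descPochhammer ℚ l * (C ((m : ℚ) ^ s) * X ^ t * (X - C (b : ℚ)) ^ m) =
        (m : ℚ) ^ s • (descPochhammer ℚ l * (X ^ t * (X - C (b : ℚ)) ^ m)) := by
      rw [smul_eq_C_mul]; ring
    rw [hr, map_smul, bellFunctional_descPochhammer_mul_X_sub_pow hb, ← hg,
      bellFunctional_mul_X_pow (D := N + k + 1) (by omega), sum_Icc_neg_eq_sum_range,
      smul_eq_mul, Finset.mul_sum]
    refine Finset.sum_congr rfl fun i _ => ?_
    have h1 : ((i : ℤ) - k + k).toNat = i := by omega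
    have h2 : ((m : ℤ) + k + ((i : ℤ) - k)).toNat = m + i := by omega
    beta_reduce
    rw [h1, h2]
    simp only [eval_mul, eval_C, eval_pow, eval_sub, eval_X, add_sub_cancel_right]
    ring
  · rw [Finset.mem_Icc] at hj
    by_cases h0 : g.coeff (j + k).toNat = 0
    · simp [h0]
    · have hle := (le_natDegree_of_ne_zero h0).trans hgd
      refine (natDegree_C_mul_le _ _).trans ?_
      rw [natDegree_pow, natDegree_X_sub_C, mul_one]
      exact hβ j hj.1 s (by omega) (by omega)

end ShiftedBell

section Aggregate

open Polynomial

variable {k : ℕ}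

theorem card_filter_image_lt {n : ℕ} {x : Fin k → Fin n} (hx : StrictMono x) (y : Fin n) :
    #((Finset.univ.image fun i : Fin k => (x i : ℕ)).filter fun z => z < (y : ℕ)) = gapIndex x y := by
  rw [Finset.filter_image, Finset.card_image_of_injective (f := fun i => (x i : ℕ)) _
    (Fin.val_injective.comp hx.injective)]
  rfl

theorem gapIndex_apply_self {n : ℕ} {x : Fin k → Fin n} (hx : StrictMono x) (i : Fin k) :
    gapIndex x (x i) = i := by
  unfold gapIndex
  simp only [hx.lt_iff_lt]
  rw [show ({j | j < i} : Finset (Fin k)) = Finset.Iio i by ext; simp, Fin.card_Iio]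

open Classical in
theorem sum_strictMono_eq_markedSum (w : ℕ → ℚ[X]) (h : ℕ → ℕ → ℚ) (n : ℕ) :
    ∑ x : Fin k → Fin n with StrictMono x, C (∏ i : Fin k, h i (x i)) *
      ∏ y : Fin n with y ∉ Set.range x, w (gapIndex x y) = markedSum w h k n := by
  refine Finset.sum_bij (fun x _ => Finset.univ.image fun i : Fin k => (x i : ℕ)) ?_ ?_ ?_ ?_
  · intro x hx
    simp only [mem_filter, mem_univ, true_and] at hx
    rw [Finset.mem_powersetCard, Finset.card_image_of_injective (f := fun i => (x i : ℕ)) _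
      (Fin.val_injective.comp hx.injective), Finset.card_univ, Fintype.card_fin]
    refine ⟨fun z hz => ?_, rfl⟩
    obtain ⟨i, -, rfl⟩ := Finset.mem_image.1 hz
    exact Finset.mem_range.2 (x i).isLt
  · intro x hx x' hx' hxx
    simp only [mem_filter, mem_univ, true_and] at hx hx'
    have := congrArg (fun s : Finset ℕ => (s : Set ℕ)) hxx
    simp only [Finset.coe_image, Finset.coe_univ, Set.image_univ] at this
    have hval : StrictMono (Fin.val : Fin n → ℕ) := fun _ _ h => h
    have h2 := ((hval.comp hx).range_inj (hval.comp hx')).1 this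
    funext i
    exact Fin.val_injective (congrFun h2 i)
  · intro s hs
    obtain ⟨hs1, hs2⟩ := Finset.mem_powersetCard.1 hs
    have hlt : ∀ i, s.orderEmbOfFin hs2 i < n := fun i =>
      Finset.mem_range.1 (hs1 (s.orderEmbOfFin_mem hs2 i))
    refine ⟨fun i => ⟨s.orderEmbOfFin hs2 i, hlt i⟩, ?_, ?_⟩
    · simp only [mem_filter, mem_univ, true_and]
      exact fun i j hij => (s.orderEmbOfFin hs2).strictMono hij
    · exact s.image_orderEmbOfFin_univ hs2
  · intro x hx
    simp only [mem_filter, mem_univ, true_and] at hx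
    rw [Finset.prod_range, map_prod, ← Finset.prod_filter_mul_prod_filter_not univ
      (fun y => y ∈ Set.range x)]
    simp only [card_filter_image_lt hx]
    have hmem : ∀ y : Fin n, (y : ℕ) ∈ Finset.univ.image (fun i : Fin k => (x i : ℕ)) ↔
        y ∈ Set.range x := by
      intro y
      simp [Fin.ext_iff]
    simp only [hmem]
    congr 1
    · have : (Finset.univ.filter fun y => y ∈ Set.range x) = Finset.univ.image x := by
        ext y; simp
      rw [this, Finset.prod_image fun i _ j _ hij => hx.injective hij]
      refine Finset.prod_congr rfl fun i _ => ?_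
      rw [if_pos ⟨i, rfl⟩, gapIndex_apply_self hx]
    · refine Finset.prod_congr rfl fun y hy => ?_
      rw [if_neg (Finset.mem_filter.1 hy).2]

open Classical in
theorem aggregate_eq_sum_card {n : ℕ} (pat : Pattern k) (Q : MvPolynomial (Fin (k + 1)) ℚ) :
    ∑ P : SetPartition n, simpleStat pat Q P =
      ∑ x : Fin k → Fin n,
        MvPolynomial.eval (Fin.snoc (fun i => ((x i).val : ℚ) + 1) (n : ℚ)) Q *
          #{P : SetPartition n | IsOccurrence pat P x} := by
  have h : ∀ P : SetPartition n, simpleStat pat Q P = ∑ x : Fin k → Fin n,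
      if IsOccurrence pat P x then
        MvPolynomial.eval (Fin.snoc (fun i => ((x i).val : ℚ) + 1) (n : ℚ)) Q else 0 := by
    intro P
    unfold simpleStat
    rw [finsum_mem_def, finsum_eq_sum_of_fintype]
    exact Finset.sum_congr rfl fun x _ => by simp [Set.indicator_apply]
  simp only [h]
  rw [Finset.sum_comm]
  refine Finset.sum_congr rfl fun x _ => ?_
  rw [← Finset.sum_filter, Finset.sum_const, nsmul_eq_mul, mul_comm]

theorem aggregate_eq_bellFunctional {n : ℕ} {pat : Pattern k} (hpat : pat.Consistent)
    (Q : MvPolynomial (Fin (k + 1)) ℚ) :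
    ∑ P : SetPartition n, simpleStat pat Q P =
      bellFunctional (descPochhammer ℚ #pat.part.parts * ∑ d ∈ Q.support,
        C (Q.coeff d) * (C ((n : ℚ) ^ d (Fin.last k)) *
          markedSum pat.gapWeight
            (fun i y => ((y : ℚ) + 1) ^ (if h : i < k then d (Fin.castSucc ⟨i, h⟩) else 0)) k n)) := by
  classical
  rw [aggregate_eq_sum_card]
  have hx : ∀ x : Fin k → Fin n,
      MvPolynomial.eval (Fin.snoc (fun i => ((x i).val : ℚ) + 1) (n : ℚ)) Q *
        (#{P : SetPartition n | IsOccurrence pat P x} : ℚ) =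
      if StrictMono x then bellFunctional (descPochhammer ℚ #pat.part.parts *
        ∑ d ∈ Q.support, C (Q.coeff d) * (C ((n : ℚ) ^ d (Fin.last k)) *
          (C (∏ i, (((x i).val : ℚ) + 1) ^ d (Fin.castSucc i)) *
          ∏ y : Fin n with y ∉ Set.range x, pat.gapWeight (gapIndex x y)))) else 0 := by
    intro x
    split_ifs with hm
    · rw [card_isOccurrence hpat hm, ← smul_eq_mul, ← map_smul, MvPolynomial.eval_eq']
      congr 1
      rw [smul_eq_C_mul, mul_left_comm, map_sum, Finset.sum_mul]
      congr 1
      refine Finset.sum_congr rfl fun d _ => ?_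
      rw [Fin.prod_univ_castSucc]
      simp only [Fin.snoc_castSucc, Fin.snoc_last, C_mul]
      ring
    · rw [Finset.filter_false_of_mem fun P _ h => hm h.1]
      simp
  simp only [hx]
  rw [← Finset.sum_filter, ← map_sum, ← Finset.mul_sum, Finset.sum_comm]
  congr 2
  refine Finset.sum_congr rfl fun d _ => ?_
  rw [← Finset.mul_sum, ← Finset.mul_sum, ← sum_strictMono_eq_markedSum]
  simp

theorem Pattern.gapWeight_zero (pat : Pattern k) :
    ∃ b ≤ #pat.part.parts, pat.gapWeight 0 = X - Polynomial.C (b : ℚ) := by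
  classical
  refine ⟨_, Finset.card_le_card ?_, if_neg ?_⟩
  · exact Finset.image_subset_iff.2 fun i _ => pat.part.part_mem.2 (mem_univ i)
  · rintro ⟨p, -, h⟩
    omega

theorem Pattern.gapWeight_eq (pat : Pattern k) (g : ℕ) :
    pat.gapWeight g = 0 ∨ ∃ b ≤ #pat.part.parts, pat.gapWeight g = X - Polynomial.C (b : ℚ) := by
  classical
  by_cases h : pat.Blocked g
  · exact Or.inl (if_pos h)
  · refine Or.inr ⟨_, Finset.card_le_card ?_, if_neg h⟩
    exact Finset.image_subset_iff.2 fun i _ => pat.part.part_mem.2 (mem_univ i)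

theorem sum_exponents_le_totalDegree {Q : MvPolynomial (Fin (k + 1)) ℚ} {d : Fin (k + 1) →₀ ℕ}
    (hd : d ∈ Q.support) :
    (∑ i ∈ Finset.range k, if h : i < k then d (Fin.castSucc ⟨i, h⟩) else 0) + d (Fin.last k) ≤
      Q.totalDegree := by
  have h := MvPolynomial.le_totalDegree hd
  rw [Finsupp.sum_fintype _ _ (fun _ => rfl), Fin.sum_univ_castSucc] at h
  rw [Finset.sum_range]
  simpa using h

theorem isShiftedBell_aggregate (pat : Pattern k) (Q : MvPolynomial (Fin (k + 1)) ℚ) {β : ℤ → ℕ}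
    (hβ : ∀ j : ℤ, -(k : ℤ) ≤ j → ∀ s : ℕ, s ≤ k + Q.totalDegree →
      (s : ℤ) + j ≤ (k + Q.totalDegree : ℕ) → s ≤ β j) :
    IsShiftedBell k (k + Q.totalDegree) β
      (fun m => ∑ P : SetPartition (m + k), simpleStat pat Q P) := by
  classical
  by_cases hpat : pat.Consistent
  · simp only [aggregate_eq_bellFunctional hpat]
    refine isShiftedBell_of_mem_expPolySpan ?_ hβ
      (U := fun m => ∑ d ∈ Q.support, C (Q.coeff d) * (C (((m + k : ℕ) : ℚ) ^ d (Fin.last k)) *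
        markedSum pat.gapWeight (fun i y => ((y : ℚ) + 1) ^
          (if h : i < k then d (Fin.castSucc ⟨i, h⟩) else 0)) k (m + k))) ?_
    · simpa using pat.part.card_parts_le_card
    · have hmem : ∀ d ∈ Q.support, (fun m : ℕ => C (Q.coeff d) *
          (C (((m + k : ℕ) : ℚ) ^ d (Fin.last k)) *
          markedSum pat.gapWeight (fun i y => ((y : ℚ) + 1) ^
            (if h : i < k then d (Fin.castSucc ⟨i, h⟩) else 0)) k (m + k))) ∈
          expPolySpan #pat.part.parts (k + Q.totalDegree) := by
        intro d hd
        refine C_mul_mem_expPolySpan ?_ _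
        push_cast
        have hle := sum_exponents_le_totalDegree hd
        refine expPolySpan_mono ?_ (index_add_pow_mul_mem_expPolySpan
          (markedSum_mem_expPolySpan pat.gapWeight_zero pat.gapWeight_eq
            (fun i => if h : i < k then d (Fin.castSucc ⟨i, h⟩) else 0) k) (k : ℚ) _)
        rw [add_assoc]
        exact Nat.add_le_add_left hle k
      convert Submodule.sum_mem _ hmem using 1
      funext m
      rw [Finset.sum_apply]
  · have h0 : (fun m => ∑ P : SetPartition (m + k), simpleStat pat Q P) = fun _ => (0 : ℚ) := by
      funext m
      rw [aggregate_eq_sum_card]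
      refine Finset.sum_eq_zero fun x _ => ?_
      rw [Finset.filter_false_of_mem fun P _ h => hpat h.consistent]
      simp
    rw [h0]
    exact mem_shiftedBellSubmodule.1 (Submodule.zero_mem _)

end Aggregate

/-- The aggregate of a simple statistic of degree `N = k + deg Q` is a shifted Bell
polynomial `Σ_{j=-k}^{N} Q_j(n) B_{n+j}`, where the coefficient of `B_{n+N-j}` has
degree at most `j` for `0 ≤ j ≤ N` and at most `j - 1` for `j > N`. -/
theorem aggregate_simpleStat_shiftedBell (k : ℕ) (pat : Pattern k)
    (Q : MvPolynomial (Fin (k + 1)) ℚ) :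
    ∃ R : ℤ → Polynomial ℚ,
      (∀ n : ℕ, k ≤ n →
        ∑ P : SetPartition n, simpleStat pat Q P =
          ∑ j ∈ Finset.Icc (-(k : ℤ)) ((k : ℤ) + Q.totalDegree),
            (R j).eval (n : ℚ) * (bell ((n : ℤ) + j).toNat : ℚ)) ∧
      (∀ j ∈ Finset.Icc (-(k : ℤ)) ((k : ℤ) + Q.totalDegree),
        (0 ≤ j → (R j).natDegree ≤ (((k : ℤ) + Q.totalDegree) - j).toNat) ∧
        (j < 0 → (R j).natDegree ≤ (((k : ℤ) + Q.totalDegree) - j - 1).toNat)) := by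
  let β : ℤ → ℕ := fun j => if 0 ≤ j then (((k : ℤ) + Q.totalDegree) - j).toNat
    else (((k : ℤ) + Q.totalDegree) - j - 1).toNat
  obtain ⟨R, h1, h2⟩ := isShiftedBell_aggregate pat Q (β := β) (by
    intro j _ s hs hsj
    simp only [β]
    split_ifs <;> omega)
  push_cast at h1 h2
  refine ⟨R, fun n hn => ?_, fun j hj => ⟨fun h0 => ?_, fun h0 => ?_⟩⟩
  · obtain ⟨m, rfl⟩ := Nat.exists_eq_add_of_le' hn
    rw [h1 m]
    push_cast
    rfl
  · simpa only [β, if_pos h0] using h2 j hj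
  · simpa only [β, if_neg (not_le.2 h0)] using h2 j hj
end

section
/- For every n ≥ 1, the sum over all set partitions λ of [n] of d(λ)^2 equals 4B_{n+4} − (4n+15)B_{n+3} + (n^2+8n+9)B_{n+2} − (4n+3)B_{n+1} + n·B_n. -/
open Finset

/-- The number of ways of extending a set partition with `k` blocks by `m` further elements,
as a polynomial in `k`. -/
def bellPoly : ℕ → ℤ → ℤ
  | 0, _ => 1
  | m + 1, k => bellPoly m (k + 1) + k * bellPoly m k

lemma bellPoly_add_one (m : ℕ) (k : ℤ) :
    bellPoly m (k + 1) = bellPoly (m + 1) k - k * bellPoly m k := by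
  simp [bellPoly]

/-- The sum of the increments of the dimension exponent over all extensions by `m` elements of a
set partition with `k` blocks, all of whose gaps vanish. -/
def dimExpSum (m : ℕ) (k : ℤ) : ℤ :=
  (k ^ 2 - k) * bellPoly m (k - 1)
    + (4 - 3 * k - k ^ 2 + (1 - k) * m) * bellPoly (m + 1) (k - 1)
    + (2 + 3 * k + m) * bellPoly (m + 2) (k - 1)
    - 2 * bellPoly (m + 3) (k - 1)

/-- Twice the sum of the squared increments of the dimension exponent over all extensions by `m`
elements of a set partition with `k` blocks, all of whose gaps vanish. -/
def dimExpSqSum (m : ℕ) (k : ℤ) : ℤ :=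
  (4 * k ^ 2 - 6 * k ^ 3 + 2 * k ^ 4 + (4 - 6 * k + 2 * k ^ 2) * m) * bellPoly m (k - 2)
    + (-12 - 5 * k + 24 * k ^ 2 - 5 * k ^ 4 + (-10 + 12 * k + 4 * k ^ 2 - 4 * k ^ 3) * m)
      * bellPoly (m + 1) (k - 2)
    + (18 - 21 * k - 35 * k ^ 2 + 24 * k ^ 3 + 2 * k ^ 4
      + (10 - 28 * k + 8 * k ^ 2 + 4 * k ^ 3) * m + (4 - 6 * k + 2 * k ^ 2) * m ^ 2)
      * bellPoly (m + 2) (k - 2)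
    + (-12 + 87 * k - 41 * k ^ 2 - 12 * k ^ 3 + (24 + 4 * k - 16 * k ^ 2) * m
      + (6 - 4 * k) * m ^ 2) * bellPoly (m + 3) (k - 2)
    + (-56 + 28 * k + 26 * k ^ 2 + (-8 + 20 * k) * m + 2 * m ^ 2) * bellPoly (m + 4) (k - 2)
    + (-6 - 24 * k - 8 * m) * bellPoly (m + 5) (k - 2)
    + 8 * bellPoly (m + 6) (k - 2)

/-- Twice the sum of the squared dimension exponents over all extensions by `m` elements of a set
partition with `k` blocks, dimension exponent `d`, sum of gaps `S` and sum of squared gaps `Q`. -/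
def potential (m : ℕ) (k d S Q : ℤ) : ℤ :=
  2 * (bellPoly m k * d ^ 2
    + d * (2 * (bellPoly m k - bellPoly m (k - 1)) * S + 2 * dimExpSum m k)
    + (bellPoly m (k - 1) - bellPoly m (k - 2)) * Q
    + (bellPoly m k - 2 * bellPoly m (k - 1) + bellPoly m (k - 2)) * S ^ 2
    + 2 * (dimExpSum m k - dimExpSum m (k - 1)) * S)
    + dimExpSqSum m k

lemma potential_zero (k d S Q : ℤ) : potential 0 k d S Q = 2 * d ^ 2 := by
  simp only [potential, dimExpSum, dimExpSqSum, bellPoly]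
  push_cast
  ring

lemma two_mul_eq_potential_zero (m : ℕ) :
    potential m 0 0 0 0 =
      2 * (4 * bellPoly (m + 4) 0 - (4 * (m : ℤ) + 15) * bellPoly (m + 3) 0
        + ((m : ℤ) ^ 2 + 8 * m + 9) * bellPoly (m + 2) 0
        - (4 * (m : ℤ) + 3) * bellPoly (m + 1) 0 + (m : ℤ) * bellPoly m 0) := by
  have h1 : ∀ i, bellPoly i (-1) = bellPoly (i + 1) (-2) + 2 * bellPoly i (-2) := fun i => by
    have := bellPoly_add_one i (-2)
    norm_num at this
    exact this
  have h0 : ∀ i, bellPoly i 0 = bellPoly (i + 1) (-1) + bellPoly i (-1) := fun i => by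
    have := bellPoly_add_one i (-1)
    norm_num at this
    exact this
  simp only [potential, dimExpSum, dimExpSqSum, h0, h1]
  norm_num
  simp only [add_assoc, Nat.reduceAdd]
  ring

lemma sum_potential {ι : Type*} (s : Finset ι) (g : ι → ℤ) (m : ℕ) (d : ℤ) :
    potential m (#s + 1) d (∑ b ∈ s, g b + #s) (∑ b ∈ s, g b ^ 2 + 2 * ∑ b ∈ s, g b + #s)
      + ∑ c ∈ s, potential m #s (d + g c) (∑ b ∈ s, g b + #s - 1 - g c)
          (∑ b ∈ s, g b ^ 2 + 2 * ∑ b ∈ s, g b + #s - (g c + 1) ^ 2) =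
    potential (m + 1) #s d (∑ b ∈ s, g b) (∑ b ∈ s, g b ^ 2) := by
  generalize hS : ∑ b ∈ s, g b = S
  generalize hQ : ∑ b ∈ s, g b ^ 2 = Q
  generalize hk : (#s : ℤ) = k
  have hc : ∀ c, potential m k (d + g c) (S + k - 1 - g c) (Q + 2 * S + k - (g c + 1) ^ 2) =
      potential m k d (S + k - 1) (Q + 2 * S + k - 1)
      + 2 * (2 * d * bellPoly m k
        + 2 * (bellPoly m k - bellPoly m (k - 1)) * (S + k - 1 - d) + 2 * dimExpSum m k
        - 2 * (bellPoly m (k - 1) - bellPoly m (k - 2))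
        - 2 * (S + k - 1) * (bellPoly m k - 2 * bellPoly m (k - 1) + bellPoly m (k - 2))
        - 2 * (dimExpSum m k - dimExpSum m (k - 1))) * g c
      + 2 * (2 * bellPoly m (k - 2) - bellPoly m (k - 1)) * g c ^ 2 := fun c => by
    simp only [potential]
    ring
  simp only [hc, sum_add_distrib, ← mul_sum, sum_const, nsmul_eq_mul, hS, hQ, hk]
  obtain ⟨x, rfl⟩ : ∃ x, k = x + 1 + 1 := ⟨k - 2, by ring⟩
  have e1 : x + 1 + 1 - 1 = x + 1 := by ring
  have e2 : x + 1 + 1 - 2 = x := by ring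
  have e3 : x + 1 + 1 + 1 - 2 = x + 1 := by ring
  have e4 : x + 1 + 1 + 1 - 1 = x + 1 + 1 := by ring
  have e5 : x + 1 - 1 = x := by ring
  simp only [potential, dimExpSum, dimExpSqSum, e1, e2, e3, e4, e5, bellPoly_add_one]
  push_cast
  simp only [add_assoc, Nat.reduceAdd, Nat.add_comm 1]
  ring

namespace SetPartition

variable {n : ℕ}

lemma empty_notMem (P : SetPartition n) : ∅ ∉ P.parts := P.bot_notMem

/-- The image of a block under the inclusion `Fin n → Fin (n + 1)`. -/
def lift (b : Finset (Fin n)) : Finset (Fin (n + 1)) := b.map Fin.castSuccEmb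

/-- The elements of a block other than the last element of `Fin (n + 1)`. -/
def lower (b : Finset (Fin (n + 1))) : Finset (Fin n) := {i | i.castSucc ∈ b}

@[simp] lemma castSucc_mem_lift {b : Finset (Fin n)} {i : Fin n} : i.castSucc ∈ lift b ↔ i ∈ b := by
  simp [lift]

@[simp] lemma last_notMem_lift (b : Finset (Fin n)) : Fin.last n ∉ lift b := by
  simp [lift, Fin.castSucc_ne_last]

@[simp] lemma mem_lower {b : Finset (Fin (n + 1))} {i : Fin n} : i ∈ lower b ↔ i.castSucc ∈ b := by
  simp [lower]

@[simp] lemma lower_lift (b : Finset (Fin n)) : lower (lift b) = b := by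
  ext; simp

@[simp] lemma lower_insert_lift (b : Finset (Fin n)) :
    lower (insert (Fin.last n) (lift b)) = b := by
  ext; simp [Fin.castSucc_ne_last]

lemma lift_injective : Function.Injective (lift (n := n)) :=
  Function.LeftInverse.injective lower_lift

lemma lift_lower {b : Finset (Fin (n + 1))} (hb : Fin.last n ∉ b) : lift (lower b) = b := by
  ext i
  induction i using Fin.lastCases <;> simp [hb]

lemma insert_lift_lower {b : Finset (Fin (n + 1))} (hb : Fin.last n ∈ b) :
    insert (Fin.last n) (lift (lower b)) = b := by
  ext i
  induction i using Fin.lastCases <;> simp [hb, Fin.castSucc_ne_last]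

/-- The blocks obtained by adding the last element of `Fin (n + 1)` to the block `c`
(or as a singleton block, for `c = ∅`). -/
def extendParts (s : Finset (Finset (Fin n))) (c : Finset (Fin n)) :
    Finset (Finset (Fin (n + 1))) :=
  insert (insert (Fin.last n) (lift c)) ((s.erase c).image lift)

/-- The set partition obtained by adding the last element of `Fin (n + 1)` to the block `c`
(or as a singleton block, for `c = ∅`). -/
def extend (P : SetPartition n) (c : Finset (Fin n)) (hc : c ∈ insert ∅ P.parts) :
    SetPartition (n + 1) :=
  Finpartition.ofExistsUnique (extendParts P.parts c) (fun _ _ => subset_univ _)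
    (by
      intro i _
      induction i using Fin.lastCases with
      | last =>
        refine ⟨insert (Fin.last n) (lift c), by simp [extendParts], ?_⟩
        rintro t ⟨ht, hit⟩
        simp only [extendParts, mem_insert, mem_image, mem_erase] at ht
        rcases ht with rfl | ⟨a, -, rfl⟩
        · rfl
        · exact absurd hit (last_notMem_lift a)
      | cast i =>
        obtain ⟨b, hb, hib⟩ := P.exists_mem (mem_univ i)
        by_cases hic : i ∈ c
        · have hcP : c ∈ P.parts := by
            rcases mem_insert.1 hc with rfl | h
            · simp at hic
            · exact h
          refine ⟨insert (Fin.last n) (lift c), by simp [extendParts, hic], ?_⟩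
          rintro t ⟨ht, hit⟩
          simp only [extendParts, mem_insert, mem_image, mem_erase] at ht
          rcases ht with rfl | ⟨a, ⟨hac, ha⟩, rfl⟩
          · rfl
          · exact absurd (P.eq_of_mem_parts ha hcP (castSucc_mem_lift.1 hit) hic) hac
        · refine ⟨lift b, ⟨mem_insert_of_mem (mem_image_of_mem _ (mem_erase.2 ⟨?_, hb⟩)),
            castSucc_mem_lift.2 hib⟩, ?_⟩
          · rintro rfl
            exact hic hib
          rintro t ⟨ht, hit⟩
          simp only [extendParts, mem_insert, mem_image, mem_erase] at ht
          rcases ht with rfl | ⟨a, ⟨hac, ha⟩, rfl⟩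
          · simp [Fin.castSucc_ne_last, hic] at hit
          · rw [P.eq_of_mem_parts ha hb (castSucc_mem_lift.1 hit) hib])
    (by
      simp only [extendParts, mem_insert, mem_image, mem_erase, not_or, not_exists, not_and]
      refine ⟨(insert_nonempty _ _).ne_empty.symm, fun a ha h => ?_⟩
      exact P.ne_empty ha.2 (by simpa [lift] using h))

/-- The set partition obtained by deleting the last element. -/
def restrict (P : SetPartition (n + 1)) : SetPartition n :=
  Finpartition.ofExistsUnique ((P.parts.image lower).erase ∅) (fun _ _ => subset_univ _)
    (by
      intro i _
      obtain ⟨b, hb, hib⟩ := P.exists_mem (mem_univ i.castSucc)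
      refine ⟨lower b, ⟨mem_erase.2 ⟨?_, mem_image_of_mem _ hb⟩, by simpa⟩, ?_⟩
      · exact ne_empty_of_mem (mem_lower.2 hib)
      rintro t ⟨ht, hit⟩
      obtain ⟨a, ha, rfl⟩ := mem_image.1 (mem_of_mem_erase ht)
      rw [P.eq_of_mem_parts ha hb (mem_lower.1 hit) hib])
    (by simp)

/-- The block of the last element, without that element. -/
def lastBlock (P : SetPartition (n + 1)) : Finset (Fin n) := lower (P.part (Fin.last n))

lemma lastBlock_mem (P : SetPartition (n + 1)) : lastBlock P ∈ insert ∅ (restrict P).parts := by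
  have : P.part (Fin.last n) ∈ P.parts := P.part_mem.2 (mem_univ _)
  by_cases h : lastBlock P = ∅
  · simp [h]
  · exact mem_insert_of_mem (mem_erase.2 ⟨h, mem_image_of_mem _ this⟩)

lemma parts_eq_extendParts (P : SetPartition (n + 1)) :
    P.parts = extendParts (restrict P).parts (lastBlock P) := by
  have hP : P.part (Fin.last n) ∈ P.parts := P.part_mem.2 (mem_univ _)
  have hlast : Fin.last n ∈ P.part (Fin.last n) := P.mem_part (mem_univ _)
  have key : ∀ b ∈ P.parts, b = P.part (Fin.last n) ∨ Fin.last n ∉ b := fun b hb => by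
    by_cases h : Fin.last n ∈ b
    · exact .inl (P.eq_of_mem_parts hb hP h hlast)
    · exact .inr h
  have hne : ∀ b ∈ P.parts, Fin.last n ∉ b → lower b ≠ ∅ := fun b hb h h' => by
    have := lift_lower h
    rw [h'] at this
    exact P.ne_empty hb (by simpa [lift] using this.symm)
  ext b
  simp only [extendParts, restrict, lastBlock, Finpartition.ofExistsUnique_parts, mem_insert,
    mem_image, mem_erase, insert_lift_lower hlast]
  constructor
  · intro hb
    rcases key b hb with h | h
    · exact .inl h
    · refine .inr ⟨lower b, ⟨fun heq => ?_, hne b hb h, b, hb, rfl⟩, lift_lower h⟩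
      obtain ⟨i, hi⟩ := nonempty_iff_ne_empty.2 (hne b hb h)
      have := P.eq_of_mem_parts hb hP (mem_lower.1 hi) (mem_lower.1 (heq ▸ hi))
      exact h (this ▸ hlast)
  · rintro (rfl | ⟨_, ⟨hac, -, b, hb, rfl⟩, rfl⟩)
    · exact hP
    · rcases key b hb with rfl | h
      · exact absurd rfl hac
      · rwa [lift_lower h]

lemma restrict_extend (P : SetPartition n) (c : Finset (Fin n)) (hc : c ∈ insert ∅ P.parts) :
    restrict (extend P c hc) = P := by
  have hP := empty_notMem P
  ext1
  simp only [restrict, extend, extendParts, Finpartition.ofExistsUnique_parts, image_insert,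
    lower_insert_lift, image_image]
  rw [show lower ∘ lift = (id : Finset (Fin n) → _) from funext lower_lift, image_id]
  rcases mem_insert.1 hc with rfl | h
  · simp [hP]
  · rw [insert_erase h, erase_eq_of_notMem hP]

lemma lastBlock_extend (P : SetPartition n) (c : Finset (Fin n)) (hc : c ∈ insert ∅ P.parts) :
    lastBlock (extend P c hc) = c := by
  have : (extend P c hc).part (Fin.last n) = insert (Fin.last n) (lift c) :=
    Finpartition.part_eq_of_mem _ (by simp [extend, extendParts]) (mem_insert_self _ _)
  rw [lastBlock, this, lower_insert_lift]

lemma sum_restrict_lastBlock (F : SetPartition n → Finset (Fin n) → ℤ) :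
    ∑ P : SetPartition (n + 1), F (restrict P) (lastBlock P) =
      ∑ P : SetPartition n, (F P ∅ + ∑ c ∈ P.parts, F P c) := by
  have hP : ∀ P : SetPartition n, F P ∅ + ∑ c ∈ P.parts, F P c = ∑ c ∈ insert ∅ P.parts, F P c :=
    fun P => (sum_insert (empty_notMem P)).symm
  simp only [hP]
  rw [sum_sigma']
  refine sum_bij (fun P _ => ⟨restrict P, lastBlock P⟩) (fun P _ => ?_) (fun P _ R _ h => ?_)
    (fun x hx => ?_) (fun _ _ => rfl)
  · simpa using lastBlock_mem P
  · simp only [Sigma.mk.injEq, heq_eq_eq] at h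
    ext1
    rw [parts_eq_extendParts P, parts_eq_extendParts R, h.1, h.2]
  · have hc : x.2 ∈ insert ∅ x.1.parts := (mem_sigma.1 hx).2
    exact ⟨extend x.1 x.2 hc, mem_univ _, by rw [restrict_extend, lastBlock_extend]⟩

lemma sum_extendParts (s : Finset (Finset (Fin n))) (c : Finset (Fin n))
    (f : Finset (Fin (n + 1)) → ℤ) :
    ∑ b ∈ extendParts s c, f b =
      f (insert (Fin.last n) (lift c)) + ∑ b ∈ s.erase c, f (lift b) := by
  rw [extendParts, sum_insert, sum_image lift_injective.injOn]
  intro h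
  obtain ⟨a, -, ha⟩ := mem_image.1 h
  exact last_notMem_lift a (ha ▸ mem_insert_self _ _)

/-- The largest element of a block. -/
def hi (b : Finset (Fin n)) : ℕ := b.sup Fin.val

/-- The smallest element of a block. -/
noncomputable def lo (b : Finset (Fin n)) : ℕ := sInf (Fin.val '' (b : Set (Fin n)))

/-- The number of elements of `Fin n` beyond a block. -/
def gap (b : Finset (Fin n)) : ℤ := n - 1 - hi b

@[simp] lemma hi_lift (b : Finset (Fin n)) : hi (lift b) = hi b := by
  simp [hi, lift, Finset.sup_map, Function.comp_def]

@[simp] lemma lo_lift (b : Finset (Fin n)) : lo (lift b) = lo b := by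
  simp [lo, lift, Set.image_image]

@[simp] lemma hi_insert_last (b : Finset (Fin n)) : hi (insert (Fin.last n) (lift b)) = n := by
  have : hi (lift b) ≤ n := Finset.sup_le fun i _ => Nat.lt_succ_iff.1 i.2
  rw [hi, sup_insert]
  simpa [hi] using this

lemma lo_insert_last {b : Finset (Fin n)} (hb : b.Nonempty) :
    lo (insert (Fin.last n) (lift b)) = lo b := by
  obtain ⟨i, hib⟩ := hb
  have hmem : (i : ℕ) ∈ Fin.val '' (b : Set (Fin n)) := ⟨i, hib, rfl⟩
  rw [lo, coe_insert, Set.image_insert_eq, csInf_insert (OrderBot.bddBelow _)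
    (Set.Nonempty.image _ ⟨i.castSucc, by simpa using hib⟩), ← lo, lo_lift]
  exact inf_eq_right.2 ((Nat.sInf_le hmem).trans i.2.le)

lemma lo_insert_last_empty : lo (insert (Fin.last n) (lift ∅)) = n := by
  simp [lo, lift]

lemma gap_lift (b : Finset (Fin n)) : gap (lift b) = gap b + 1 := by
  simp [gap]; ring

lemma gap_insert_last (b : Finset (Fin n)) : gap (insert (Fin.last n) (lift b)) = 0 := by
  simp [gap]

lemma dimExp_eq (P : SetPartition n) :
    dimExp P = ∑ b ∈ P.parts, ((hi b : ℤ) - lo b + 1) - n := by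
  rw [dimExp, ← sum_attach P.parts]
  congr 1
  refine sum_congr rfl fun b _ => ?_
  have hb := P.nonempty_of_mem_parts b.2
  have h1 : ((b.1.max' hb : Fin n) : ℕ) = hi b.1 :=
    le_antisymm (le_sup (f := Fin.val) (max'_mem _ _)) (Finset.sup_le fun i h => le_max' _ _ h)
  have h2 : ((b.1.min' hb : Fin n) : ℕ) = lo b.1 := by
    refine le_antisymm (le_csInf ⟨_, _, min'_mem _ hb, rfl⟩ ?_) (Nat.sInf_le ⟨_, min'_mem _ hb, rfl⟩)
    rintro _ ⟨i, h, rfl⟩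
    exact min'_le _ _ h
  rw [h1, h2]

/-- The value of `potential m` at the statistics of a set partition. -/
def potentialOf (m : ℕ) (P : SetPartition n) : ℤ :=
  potential m #P.parts (dimExp P) (∑ b ∈ P.parts, gap b) (∑ b ∈ P.parts, gap b ^ 2)

section Statistics

variable (P : SetPartition (n + 1))

lemma card_parts_of_lastBlock :
    (#P.parts : ℤ) = 1 + #((restrict P).parts.erase (lastBlock P)) := by
  have := sum_extendParts (restrict P).parts (lastBlock P) (fun _ => 1)
  rw [← parts_eq_extendParts] at this
  simpa using this

lemma sum_gap_of_lastBlock :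
    ∑ b ∈ P.parts, gap b = ∑ b ∈ (restrict P).parts.erase (lastBlock P), (gap b + 1) := by
  rw [parts_eq_extendParts, sum_extendParts, gap_insert_last, zero_add]
  simp only [gap_lift]

lemma sum_gap_sq_of_lastBlock :
    ∑ b ∈ P.parts, gap b ^ 2 =
      ∑ b ∈ (restrict P).parts.erase (lastBlock P), (gap b + 1) ^ 2 := by
  rw [parts_eq_extendParts, sum_extendParts, gap_insert_last]
  simp [gap_lift]

lemma dimExp_of_lastBlock :
    dimExp P = (n - lo (insert (Fin.last n) (lift (lastBlock P))) + 1 : ℤ)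
      + ∑ b ∈ (restrict P).parts.erase (lastBlock P), ((hi b : ℤ) - lo b + 1) - (n + 1) := by
  rw [dimExp_eq, parts_eq_extendParts, sum_extendParts]
  simp

end Statistics

lemma potentialOf_eq (m : ℕ) (P : SetPartition (n + 1)) :
    potentialOf m P =
      if lastBlock P = ∅ then
        potential m (#(restrict P).parts + 1) (dimExp (restrict P))
          (∑ b ∈ (restrict P).parts, gap b + #(restrict P).parts)
          (∑ b ∈ (restrict P).parts, gap b ^ 2 + 2 * ∑ b ∈ (restrict P).parts, gap b
            + #(restrict P).parts)
      else
        potential m #(restrict P).parts (dimExp (restrict P) + gap (lastBlock P))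
          (∑ b ∈ (restrict P).parts, gap b + #(restrict P).parts - 1 - gap (lastBlock P))
          (∑ b ∈ (restrict P).parts, gap b ^ 2 + 2 * ∑ b ∈ (restrict P).parts, gap b
            + #(restrict P).parts - (gap (lastBlock P) + 1) ^ 2) := by
  have hsq : ∑ b ∈ (restrict P).parts, (gap b + 1) ^ 2 = ∑ b ∈ (restrict P).parts, gap b ^ 2
      + 2 * ∑ b ∈ (restrict P).parts, gap b + #(restrict P).parts := by
    simp [add_sq, sum_add_distrib, mul_sum]
  have hgap : ∑ b ∈ (restrict P).parts, (gap b + 1) = ∑ b ∈ (restrict P).parts, gap b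
      + #(restrict P).parts := by
    simp [sum_add_distrib]
  have hd := dimExp_eq (restrict P)
  rw [potentialOf, dimExp_of_lastBlock, card_parts_of_lastBlock, sum_gap_of_lastBlock,
    sum_gap_sq_of_lastBlock]
  split_ifs with h
  · rw [h, erase_eq_of_notMem (empty_notMem _), hsq, hgap, lo_insert_last_empty]
    congr 1
    · ring
    · rw [hd]; ring
  · have hmem : lastBlock P ∈ (restrict P).parts := (mem_insert.1 (lastBlock_mem P)).resolve_left h
    rw [lo_insert_last (nonempty_iff_ne_empty.2 h), sum_erase_eq_sub hmem, sum_erase_eq_sub hmem,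
      sum_erase_eq_sub hmem, hsq, hgap, card_erase_of_mem hmem,
      Nat.cast_pred (card_pos.2 ⟨_, hmem⟩), hd]
    congr 1
    · ring
    · rw [gap]; ring
    · ring

lemma sum_potentialOf_succ (m n : ℕ) :
    ∑ P : SetPartition (n + 1), potentialOf m P =
      ∑ P : SetPartition n, potentialOf (m + 1) P := by
  simp only [potentialOf_eq]
  rw [sum_restrict_lastBlock fun P c => if c = ∅ then
    potential m (#P.parts + 1) (dimExp P) (∑ b ∈ P.parts, gap b + #P.parts)
      (∑ b ∈ P.parts, gap b ^ 2 + 2 * ∑ b ∈ P.parts, gap b + #P.parts)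
    else potential m #P.parts (dimExp P + gap c) (∑ b ∈ P.parts, gap b + #P.parts - 1 - gap c)
      (∑ b ∈ P.parts, gap b ^ 2 + 2 * ∑ b ∈ P.parts, gap b + #P.parts - (gap c + 1) ^ 2)]
  refine sum_congr rfl fun P _ => ?_
  rw [potentialOf, ← sum_potential, if_pos rfl]
  congr 1
  exact sum_congr rfl fun c hc => if_neg (P.ne_empty hc)

lemma sum_bellPoly_succ (m n : ℕ) :
    ∑ P : SetPartition (n + 1), bellPoly m #P.parts =
      ∑ P : SetPartition n, bellPoly (m + 1) #P.parts := by
  have key : ∀ P : SetPartition (n + 1), bellPoly m #P.parts =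
      if lastBlock P = ∅ then bellPoly m (#(restrict P).parts + 1)
      else bellPoly m #(restrict P).parts := fun P => by
    rw [card_parts_of_lastBlock]
    split_ifs with h
    · rw [h, erase_eq_of_notMem (empty_notMem _), add_comm]
    · have hmem : lastBlock P ∈ (restrict P).parts :=
        (mem_insert.1 (lastBlock_mem P)).resolve_left h
      rw [card_erase_of_mem hmem, Nat.cast_pred (card_pos.2 ⟨_, hmem⟩)]
      congr 1
      ring
  simp only [key]
  rw [sum_restrict_lastBlock fun P c => if c = ∅ then bellPoly m (#P.parts + 1)
    else bellPoly m #P.parts]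
  refine sum_congr rfl fun P _ => ?_
  rw [if_pos rfl, sum_congr rfl fun c hc => if_neg (P.ne_empty hc)]
  simp [bellPoly]

lemma sum_eq_of_isEmpty (F : SetPartition 0 → ℤ) (c : ℤ)
    (h : ∀ P : SetPartition 0, P.parts = ∅ → F P = c) : ∑ P, F P = c := by
  have hP : ∀ P : SetPartition 0, P.parts = ∅ := fun P =>
    Finpartition.parts_eq_empty_iff.2 (by simp)
  have hu : ∀ P : SetPartition 0, P = Finpartition.ofExistsUnique ∅ (by simp) (by simp) (by simp) :=
    fun P => by ext1; simp [hP]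
  rw [Fintype.sum_eq_single _ fun x hx => absurd (hu x) hx, h _ (hP _)]

lemma sum_potentialOf (m n : ℕ) :
    ∑ P : SetPartition n, potentialOf m P = potential (n + m) 0 0 0 0 := by
  induction n generalizing m with
  | zero =>
    refine sum_eq_of_isEmpty _ _ fun P hP => ?_
    simp [potentialOf, dimExp_eq, hP]
  | succ n ih => rw [sum_potentialOf_succ, ih, add_right_comm, add_assoc]

lemma sum_bellPoly (m n : ℕ) :
    ∑ P : SetPartition n, bellPoly m #P.parts = bellPoly (n + m) 0 := by
  induction n generalizing m with
  | zero =>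
    refine sum_eq_of_isEmpty _ _ fun P hP => ?_
    simp [hP]
  | succ n ih => rw [sum_bellPoly_succ, ih, add_right_comm, add_assoc]

end SetPartition

lemma bell_eq_bellPoly (n : ℕ) : (bell n : ℤ) = bellPoly n 0 := by
  simpa [bellPoly, bell] using SetPartition.sum_bellPoly 0 n

/-- `Σ_{λ ∈ Π(n)} d(λ)² = 4B_{n+4} - (4n+15)B_{n+3} + (n²+8n+9)B_{n+2} - (4n+3)B_{n+1} + n·B_n`. -/
theorem sum_dimExp_sq (n : ℕ) (hn : 1 ≤ n) :
    (∑ P : SetPartition n, (dimExp P) ^ 2) =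
      4 * (bell (n + 4) : ℤ) - (4 * (n : ℤ) + 15) * bell (n + 3)
        + ((n : ℤ) ^ 2 + 8 * n + 9) * bell (n + 2)
        - (4 * (n : ℤ) + 3) * bell (n + 1) + (n : ℤ) * bell n := by
  have h := SetPartition.sum_potentialOf 0 n
  simp only [SetPartition.potentialOf, potential_zero, ← mul_sum, add_zero,
    two_mul_eq_potential_zero] at h
  simpa only [bell_eq_bellPoly] using mul_left_cancel₀ two_ne_zero h
end
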